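/- arXiv:1811.08231 — 6 statements merged into one kernel-verified Lean document; each statement's English description precedes it below -/
import Mathlib

section
/- The infinite word w₅ = G(F^ω(0)) over the 5-letter alphabet {a,b,c,d,e} avoids every conjugacy class of length at least 2: for every factor u of w₅ with |u| ≥ 2, there exists a conjugate (cyclic rotation) of u that is not a factor of w₅. -/
/-- The morphism F on the alphabet Σ = {0,1,2,3,4}. -/
def F : Fin 5 → List (Fin 5)
  | 0 => [0, 1]
  | 1 => [2]
  | 2 => [0, 3]
  | 3 => [2, 4]
  | 4 => [2, 3]

/-- Extension of F to words. -/
def Fw (w : List (Fin 5)) : List (Fin 5) := w.flatMap F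

/-- `u` is a factor of the fixed point F^ω(0). -/
def FactorF (u : List (Fin 5)) : Prop := ∃ n, u <:+: Fw^[n] [0]

/-- `v` is a conjugate (cyclic rotation) of `u`. -/
def Conj (u v : List (Fin 5)) : Prop := ∃ s t, u = s ++ t ∧ v = t ++ s

/-- The morphism G : Σ* → Δ*, where Δ = {a,b,c,d,e} is coded as
`a = 0, b = 1, c = 2, d = 3, e = 4`. -/
def G : Fin 5 → List (Fin 5)
  | 0 => [0, 1, 2, 3]      -- abcd
  | 1 => []                -- ε
  | 2 => [4, 0, 2, 3]      -- eacd
  | 3 => [1, 4, 2, 3]      -- becd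
  | 4 => [1, 4]            -- be

/-- Extension of G to words. -/
def Gw (w : List (Fin 5)) : List (Fin 5) := w.flatMap G

/-- `u` is a factor of w₅ = G(F^ω(0)). -/
def FactorW5 (u : List (Fin 5)) : Prop := ∃ n, u <:+: Gw (Fw^[n] [0])

/-! ### Morphisms whose images can be located in a word -/

/-- The images of `f` are delimited: `P X Y` tells, from the letters around the position between `X`
and `Y`, that this position is a boundary between two images of letters. -/
structure Delimited (f : Fin 5 → List (Fin 5)) (P : List (Fin 5) → List (Fin 5) → Prop) :
    Prop where
  start : ∀ X a Z, P X (f a ++ Z)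
  cut : ∀ a X₀ X Y Z, f a = X ++ Y → X ≠ [] → Y ≠ [] → (Z = [] ∨ P [] Z) →
    ¬ P (X₀ ++ X) (Y ++ Z)
  mono : ∀ X₀ X Y t, P X Y → P (X₀ ++ X) (Y ++ t)
  inj : ∀ a b, f a = f b → a = b
  ne : ∀ a, f a ≠ []

namespace Delimited

variable {f : Fin 5 → List (Fin 5)} {P : List (Fin 5) → List (Fin 5) → Prop}

theorem flatMap_start (h : Delimited f P) (X : List (Fin 5)) {m : List (Fin 5)} (hm : m ≠ [])
    (Z : List (Fin 5)) : P X (m.flatMap f ++ Z) := by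
  cases m with
  | nil => exact absurd rfl hm
  | cons a m => simpa using h.start X a _

theorem flatMap_nil_or (h : Delimited f P) (m : List (Fin 5)) :
    m.flatMap f = [] ∨ P [] (m.flatMap f) := by
  by_cases hm : m = []
  · simp [hm]
  · simpa using Or.inr (h.flatMap_start [] hm [])

theorem exists_split (h : Delimited f P) (X₀ : List (Fin 5)) {m X Y : List (Fin 5)}
    (e : m.flatMap f = X ++ Y) (hP : P (X₀ ++ X) Y) :
    ∃ m₁ m₂, m = m₁ ++ m₂ ∧ m₁.flatMap f = X ∧ m₂.flatMap f = Y := by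
  induction m generalizing X₀ X with
  | nil =>
    obtain ⟨rfl, rfl⟩ : X = [] ∧ Y = [] := by simpa using e
    exact ⟨[], [], by simp⟩
  | cons a m ih =>
    rw [List.flatMap_cons, List.append_eq_append_iff] at e
    rcases e with ⟨X', rfl, e⟩ | ⟨Y', e, rfl⟩
    · rw [← List.append_assoc] at hP
      obtain ⟨m₁, m₂, rfl, rfl, rfl⟩ := ih _ e hP
      exact ⟨a :: m₁, m₂, by simp⟩
    · by_cases hX : X = []
      · subst hX
        exact ⟨[], a :: m, rfl, rfl, by simp [e]⟩
      by_cases hY : Y' = []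
      · subst hY
        exact ⟨[a], m, rfl, by simpa using e, rfl⟩
      exact absurd hP (h.cut a X₀ X Y' _ e hX hY (h.flatMap_nil_or m))

theorem flatMap_injective (h : Delimited f P) {m m' : List (Fin 5)}
    (e : m.flatMap f = m'.flatMap f) : m = m' := by
  induction m generalizing m' with
  | nil =>
    cases m' with
    | nil => rfl
    | cons b m' => simp [h.ne] at e
  | cons a m ih =>
    cases m' with
    | nil => simp [h.ne] at e
    | cons b m' =>
      simp only [List.flatMap_cons] at e
      have key : ∀ {a b : Fin 5} {m m' Y : List (Fin 5)}, f b = f a ++ Y → m.flatMap f = Y ++ m'.flatMap f → Y = [] := by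
        intro a b m m' Y e₁ e₂
        by_contra hY
        have hm : m ≠ [] := by rintro rfl; simp_all
        have := h.flatMap_start (f a) hm []
        rw [e₂, List.append_nil] at this
        exact h.cut b [] _ _ _ e₁ (h.ne a) hY (h.flatMap_nil_or m') this
      have hab : f a = f b := by
        rcases List.append_eq_append_iff.1 e with ⟨Y, e₁, e₂⟩ | ⟨Y, e₁, e₂⟩
        · simp [e₁, key e₁ e₂]
        · simp [e₁, key e₁ e₂]
      rw [hab, List.append_cancel_left_eq] at e
      rw [h.inj a b hab, ih e]

theorem exists_split_middle (h : Delimited f P) {m X B Y : List (Fin 5)}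
    (e : m.flatMap f = X ++ (B.flatMap f ++ Y)) (hP : P (X ++ B.flatMap f) Y) :
    ∃ m₁ m₂, m = m₁ ++ (B ++ m₂) ∧ m₁.flatMap f = X ∧ m₂.flatMap f = Y := by
  have hP' : P ([] ++ X) (B.flatMap f ++ Y) := by
    by_cases hB : B = []
    · simpa [hB] using hP
    · exact h.flatMap_start _ hB Y
  obtain ⟨m₁, m', rfl, rfl, e'⟩ := h.exists_split [] e hP'
  obtain ⟨b, m₂, rfl, eb, rfl⟩ := h.exists_split _ e' hP
  obtain rfl := h.flatMap_injective eb
  exact ⟨m₁, m₂, rfl, rfl, rfl⟩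

/-- A word beginning at a boundary is an image of a word, provided that one can read off an image
of a letter at each boundary of the word followed by a copy of itself. -/
theorem exists_flatMap_eq (h : Delimited f P) {C : List (Fin 5)} (hC : P [] C)
    (token : ∀ Z, Z <:+ C ++ C → C.length < Z.length → P [] Z →
      ∃ a Z', Z = f a ++ Z' ∧ P [] Z') :
    ∃ V : List (Fin 5), C = V.flatMap f := by
  suffices H : ∀ n, ∀ Y, Y.length = n → Y <:+ C → P [] (Y ++ C) → ∃ V : List (Fin 5), Y = V.flatMap f from
    H _ C rfl List.suffix_rfl (by simpa using h.mono [] [] C C hC)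
  intro n
  induction n using Nat.strong_induction_on with
  | _ n ih =>
    rintro Y rfl hY hP
    by_cases hY0 : Y = []
    · exact ⟨[], by simp [hY0]⟩
    have hlen : 0 < Y.length := List.length_pos_iff.2 hY0
    obtain ⟨a, Z', e, hZ⟩ := token (Y ++ C)
      (by obtain ⟨t, rfl⟩ := hY; exact ⟨t, by simp⟩) (by simp; omega) hP
    rcases List.append_eq_append_iff.1 e with ⟨Y', e₁, e₂⟩ | ⟨Y', rfl, rfl⟩
    · by_cases hY' : Y' = []
      · exact ⟨[a], by simp [e₁, hY']⟩
      · refine absurd ?_ (h.cut a [] Y Y' Z' e₁ hY0 hY' (Or.inr hZ))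
        rw [← e₂]
        simpa using h.mono Y [] C [] hC
    · obtain ⟨V, rfl⟩ := ih Y'.length (by simpa using List.length_pos_iff.2 (h.ne a)) Y' rfl
        (by obtain ⟨t, rfl⟩ := hY; exact ⟨t ++ f a, by simp⟩) hZ
      exact ⟨a :: V, by simp⟩

end Delimited

theorem exists_prefix_flatMap {f : Fin 5 → List (Fin 5)} {c : ℕ} (hc : ∀ a, c ≤ (f a).length)
    {u m : List (Fin 5)} {j : ℕ} (hu : u.length ≤ c * j) (h : u <+: m.flatMap f) :
    ∃ v, v <+: m ∧ v.length ≤ j ∧ u <+: v.flatMap f := by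
  induction m generalizing u j with
  | nil => exact ⟨[], by simp, by simp, h⟩
  | cons a m ih =>
    cases j with
    | zero => exact ⟨[], by simp, by simp, by simp_all⟩
    | succ j =>
      have hd : u.drop (f a).length <+: m.flatMap f := by
        simpa using h.drop (f a).length
      obtain ⟨v, hv, hj, hp⟩ := ih (j := j)
        (by have := hc a; simp [Nat.mul_succ] at hu ⊢; omega) hd
      refine ⟨a :: v, by simpa using hv, by simpa using hj, ?_⟩
      rcases List.prefix_or_prefix_of_prefix h (List.prefix_append _ _) with h' | h'
      · exact h'.trans (by simp)
      · obtain ⟨t, rfl⟩ := h'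
        simpa using hp

theorem exists_infix_flatMap {f : Fin 5 → List (Fin 5)} {c : ℕ} (hc : ∀ a, c ≤ (f a).length)
    {u m : List (Fin 5)} {j : ℕ} (hu : u.length ≤ c * j + 1) (h : u <:+: m.flatMap f) :
    ∃ v, v <:+: m ∧ v.length ≤ j + 1 ∧ u <:+: v.flatMap f := by
  obtain ⟨X, Y, e⟩ := h
  induction m generalizing X with
  | nil => exact ⟨[], by simp, by simp, X, Y, e⟩
  | cons a m ih =>
    rw [List.flatMap_cons, List.append_assoc, eq_comm, List.append_eq_append_iff] at e
    rcases e with ⟨X', rfl, e⟩ | ⟨Z, e₁, e₂⟩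
    · obtain ⟨v, hv, h⟩ := ih X' (by rw [e, List.append_assoc])
      exact ⟨v, hv.trans (List.suffix_cons a m).isInfix, h⟩
    · by_cases hZ : Z = []
      · subst hZ
        obtain ⟨v, hv, h⟩ := ih [] (by simpa using e₂)
        exact ⟨v, hv.trans (List.suffix_cons a m).isInfix, h⟩
      have hpos : 0 < Z.length := List.length_pos_iff.2 hZ
      have hu' : u <+: Z ++ m.flatMap f := ⟨Y, e₂⟩
      obtain ⟨v, hv, hj, hp⟩ := exists_prefix_flatMap hc (u := u.drop Z.length) (m := m) (j := j)
        (by simp; omega) (by simpa using hu'.drop Z.length)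
      refine ⟨a :: v, (List.cons_prefix_cons.2 ⟨rfl, hv⟩).isInfix, by simpa using hj, ?_⟩
      have hp' : u <+: Z ++ v.flatMap f := by
        rcases List.prefix_or_prefix_of_prefix hu' (List.prefix_append _ _) with h' | h'
        · exact h'.trans (List.prefix_append _ _)
        · obtain ⟨t, rfl⟩ := h'
          simpa using hp
      exact hp'.isInfix.trans ⟨X, [], by simp [e₁]⟩

/-! ### The morphism `F` and the coded morphism `G ∘ F` -/

/-- The image under `G` of the image under `F` of a letter. -/
def H (a : Fin 5) : List (Fin 5) := Gw (F a)

/-- Extension of `H` to words. -/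
def Hw (w : List (Fin 5)) : List (Fin 5) := w.flatMap H

theorem Gw_Fw (w : List (Fin 5)) : Gw (Fw w) = Hw w := by
  simp only [Gw, Fw, Hw, List.flatMap_assoc]
  rfl

def BoundaryF (_ Y : List (Fin 5)) : Prop := [0] <+: Y ∨ [2] <+: Y

def BoundaryH (X Y : List (Fin 5)) : Prop :=
  [0, 1] <+: Y ∨ [4, 0, 2] <+: Y ∨ ([3] <:+ X ∧ ([0] <+: Y ∨ [4] <+: Y))

instance : DecidableRel BoundaryF := fun _ _ => inferInstanceAs (Decidable (_ ∨ _))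
instance : DecidableRel BoundaryH := fun _ _ => inferInstanceAs (Decidable (_ ∨ _))

theorem take_drop_of_eq_append {X Y Z : List (Fin 5)} (e : Z = X ++ Y) (hY : Y ≠ []) {c : ℕ}
    (hc : Z.length ≤ c) : Z.take X.length = X ∧ Z.drop X.length = Y ∧ X.length < c := by
  subst e
  have := List.length_pos_iff.2 hY
  simp only [List.length_append] at hc
  exact ⟨by simp, by simp, by omega⟩

theorem delimitedF : Delimited F BoundaryF where
  start X a Z := by fin_cases a <;> simp [F, BoundaryF]
  cut a X₀ X Y Z e hX hY hZ hP := by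
    have key : ∀ a, ∀ n < 2, (F a).take n ≠ [] → (F a).drop n ≠ [] →
        (F a).drop n = [1] ∨ (F a).drop n = [3] ∨ (F a).drop n = [4] := by decide
    obtain ⟨hX', hY', hlen⟩ := take_drop_of_eq_append e hY (c := 2)
      ((by decide : ∀ a, (F a).length ≤ 2) a)
    rw [← hX'] at hX
    rw [← hY'] at hY hP
    rcases key a _ hlen hX hY with h | h | h <;> simp [h, BoundaryF] at hP
  mono X₀ X Y t h := by
    rcases h with h | h
    · exact Or.inl (h.trans (List.prefix_append _ _))
    · exact Or.inr (h.trans (List.prefix_append _ _))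
  inj := by decide
  ne := by decide

theorem delimitedH : Delimited H BoundaryH where
  start X a Z := by fin_cases a <;> simp [H, F, Gw, G, BoundaryH]
  cut a X₀ X Y Z e hX hY hZ hP := by
    have key : ∀ a, ∀ n < 8, (H a).take n ≠ [] → (H a).drop n ≠ [] →
        ∀ z ∈ [[], [0, 1], [4, 0]], ¬ BoundaryH ((H a).take n) ((H a).drop n ++ z) := by
      decide +kernel
    obtain ⟨hX', hY', hlen⟩ := take_drop_of_eq_append e hY (c := 8)
      ((by decide : ∀ a, (H a).length ≤ 8) a)
    have hz : Z.take 2 ∈ [[], [0, 1], [4, 0]] := by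
      rcases hZ with rfl | ⟨t, rfl⟩ | ⟨t, rfl⟩ | ⟨h, -⟩
      · simp
      · simp
      · simp
      · simp at h
    have hpre : ∀ {p : List (Fin 5)}, p.length ≤ 3 → p <+: Y ++ Z → p <+: Y ++ Z.take 2 := by
      intro p hp h
      refine List.prefix_of_prefix_length_le h ?_ ?_
      · exact List.prefix_append_right_inj _ |>.2 (List.take_prefix _ _)
      · have := List.length_pos_iff.2 hY
        have := h.length_le
        simp only [List.length_append, List.length_take] at *
        omega
    have hsuf : [3] <:+ X₀ ++ X → [3] <:+ X := fun h =>
      List.suffix_of_suffix_length_le h (List.suffix_append _ _) (List.length_pos_iff.2 hX)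
    refine key a _ hlen (hX'.symm ▸ hX) (hY'.symm ▸ hY) _ hz ?_
    rw [hX', hY']
    rcases hP with h | h | ⟨h₁, h₂ | h₂⟩
    · exact Or.inl (hpre (by simp) h)
    · exact Or.inr (Or.inl (hpre (by simp) h))
    · exact Or.inr (Or.inr ⟨hsuf h₁, Or.inl (hpre (by simp) h₂)⟩)
    · exact Or.inr (Or.inr ⟨hsuf h₁, Or.inr (hpre (by simp) h₂)⟩)
  mono X₀ X Y t h := by
    rcases h with h | h | ⟨h₁, h₂ | h₂⟩
    · exact Or.inl (h.trans (List.prefix_append _ _))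
    · exact Or.inr (Or.inl (h.trans (List.prefix_append _ _)))
    · exact Or.inr (Or.inr ⟨h₁.trans (List.suffix_append _ _), Or.inl (h₂.trans (List.prefix_append _ _))⟩)
    · exact Or.inr (Or.inr ⟨h₁.trans (List.suffix_append _ _), Or.inr (h₂.trans (List.prefix_append _ _))⟩)
  inj := by decide
  ne := by decide

theorem FactorF.of_infix {u v : List (Fin 5)} (hv : FactorF v) (h : u <:+: v) : FactorF u :=
  hv.imp fun _ => h.trans

theorem FactorW5.of_infix {u v : List (Fin 5)} (hv : FactorW5 v) (h : u <:+: v) : FactorW5 u :=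
  hv.imp fun _ => h.trans

theorem FactorF.exists_flatMap {u : List (Fin 5)} (hu : FactorF u) :
    ∃ m, FactorF m ∧ u <:+: m.flatMap F := by
  obtain ⟨n, h⟩ := hu
  cases n with
  | zero => exact ⟨[0], ⟨0, List.infix_rfl⟩, h.trans (by decide)⟩
  | succ n => exact ⟨_, ⟨n, List.infix_rfl⟩, by rwa [Function.iterate_succ_apply'] at h⟩

theorem FactorW5.exists_flatMap {u : List (Fin 5)} (hu : FactorW5 u) :
    ∃ m, FactorF m ∧ u <:+: m.flatMap H := by
  obtain ⟨n, h⟩ := hu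
  cases n with
  | zero => exact ⟨[0], ⟨0, List.infix_rfl⟩, h.trans (by decide)⟩
  | succ n =>
    exact ⟨_, ⟨n, List.infix_rfl⟩, by rwa [Function.iterate_succ_apply', Gw_Fw] at h⟩

/-! ### Short factors -/

/-- A word whose factors of length at most five are those of the fixed point of `F`. -/
def sample : List (Fin 5) :=
  [4, 0, 3, 2, 4, 0, 1, 2, 0, 3, 2, 3, 0, 1, 2, 4, 0, 3, 2, 3, 0, 1, 2, 0, 3, 0, 1, 2, 4, 0, 1]

/-- The factors of length `k` of `w`, and its suffixes of length less than `k`. -/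
def windows (k : ℕ) (w : List (Fin 5)) : List (List (Fin 5)) := w.tails.map (·.take k)

theorem exists_mem_windows {k : ℕ} {u w : List (Fin 5)} (h : u <:+: w) (hk : u.length ≤ k) :
    ∃ y ∈ windows k w, u <+: y := by
  obtain ⟨y, h₁, h₂⟩ := List.infix_iff_prefix_suffix.1 h
  refine ⟨y.take k, List.mem_map_of_mem (List.mem_tails _ _ |>.2 h₂), ?_⟩
  rw [List.prefix_take_iff]
  exact ⟨h₁, hk⟩

theorem infix_of_mem_windows {k : ℕ} {y w : List (Fin 5)} (hy : y ∈ windows k w) : y <:+: w := by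
  obtain ⟨v, hv, rfl⟩ := List.mem_map.1 hy
  exact (List.take_prefix _ _).isInfix.trans ((List.mem_tails _ _).1 hv).isInfix

theorem length_le_of_mem_windows {k : ℕ} {y w : List (Fin 5)} (hy : y ∈ windows k w) :
    y.length ≤ k := by
  obtain ⟨v, -, rfl⟩ := List.mem_map.1 hy
  simp

theorem FactorF.infix_sample {u : List (Fin 5)} (hu : FactorF u) (h5 : u.length ≤ 5) :
    u <:+: sample := by
  obtain ⟨n, h⟩ := hu
  have base : [0] <:+: sample := by decide
  have step : ∀ x ∈ windows 5 sample, ∀ y ∈ windows 5 (Fw x), y <:+: sample := by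
    decide +kernel
  induction n generalizing u with
  | zero => exact h.trans base
  | succ n ih =>
    rw [Function.iterate_succ_apply'] at h
    obtain ⟨v, hv, hl, huv⟩ := exists_infix_flatMap (c := 1) (j := 4) (by decide) (by omega) h
    obtain ⟨x, hx, t, rfl⟩ := exists_mem_windows (ih hl hv) hl
    obtain ⟨y, hy, hp⟩ := exists_mem_windows
      (huv.trans (show _ <:+: Fw (v ++ t) from ⟨[], Fw t, by simp [Fw]⟩)) h5
    exact hp.isInfix.trans (step _ hx y hy)

theorem FactorW5.infix_sample {u : List (Fin 5)} (hu : FactorW5 u) (h13 : u.length ≤ 13) :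
    u <:+: Hw sample := by
  obtain ⟨m, hm, h⟩ := hu.exists_flatMap
  obtain ⟨v, hv, hl, huv⟩ := exists_infix_flatMap (c := 4) (j := 3) (by decide) (by omega) h
  obtain ⟨s, t, e⟩ := (hm.of_infix hv).infix_sample (by omega)
  exact huv.trans ⟨Hw s, Hw t, by simp [← e, Hw]⟩

/-! ### Desubstitution -/

/-- `f x` can be the image just before a boundary preceded by `p`. -/
def LeftOK (f : Fin 5 → List (Fin 5)) (p : List (Fin 5)) (x : Fin 5) : Prop :=
  p <:+ f x ∨ f x <:+ p

/-- `f z` can be the image just after a boundary followed by `q`. -/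
def RightOK (f : Fin 5 → List (Fin 5)) (q : List (Fin 5)) (z : Fin 5) : Prop :=
  q <+: f z ∨
    (f z <+: q ∧ ∃ y, q.drop (f z).length <+: f y ∨ f y <+: q.drop (f z).length)

instance (f : Fin 5 → List (Fin 5)) (p : List (Fin 5)) : DecidablePred (LeftOK f p) :=
  fun _ => inferInstanceAs (Decidable (_ ∨ _))

instance (f : Fin 5 → List (Fin 5)) (q : List (Fin 5)) : DecidablePred (RightOK f q) :=
  fun _ => inferInstanceAs (Decidable (_ ∨ _))

theorem rightOK_of_prefix {f : Fin 5 → List (Fin 5)} {q : List (Fin 5)} {z : Fin 5}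
    {m : List (Fin 5)} (h : q <+: (z :: m).flatMap f) : RightOK f q z := by
  rw [List.flatMap_cons] at h
  rcases List.prefix_or_prefix_of_prefix h (List.prefix_append _ _) with h' | h'
  · exact Or.inl h'
  · refine Or.inr ⟨h', ?_⟩
    obtain ⟨q, rfl⟩ := h'
    rw [List.prefix_append_right_inj] at h
    rw [List.drop_left]
    cases m with
    | nil => exact ⟨0, Or.inl (h.trans (by simp))⟩
    | cons y m =>
      exact ⟨y, List.prefix_or_prefix_of_prefix h (by simp)⟩

theorem Delimited.exists_desubstitution {f : Fin 5 → List (Fin 5)}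
    {P : List (Fin 5) → List (Fin 5) → Prop} (h : Delimited f P) {m p B q : List (Fin 5)}
    (hm : FactorF m) (hi : p ++ (B.flatMap f ++ q) <:+: m.flatMap f) (hp : p ≠ []) (hq : q ≠ [])
    (hP : P (p ++ B.flatMap f) q) :
    ∃ x z, FactorF (x :: (B ++ [z])) ∧ LeftOK f p x ∧ RightOK f q z := by
  obtain ⟨s, t, e⟩ := hi
  have e' : m.flatMap f = (s ++ p) ++ (B.flatMap f ++ (q ++ t)) := by simp [← e]
  obtain ⟨m₁, m₂, rfl, h₁, h₂⟩ := h.exists_split_middle e' (by simpa using h.mono s _ _ t hP)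
  obtain rfl | ⟨m₁, x, rfl⟩ := m₁.eq_nil_or_concat'
  · simp_all
  cases m₂ with
  | nil => simp_all
  | cons z m₂ =>
    refine ⟨x, z, hm.of_infix ⟨m₁, m₂, by simp⟩, ?_, rightOK_of_prefix (m := m₂) ⟨t, h₂.symm⟩⟩
    simp only [List.flatMap_append, List.flatMap_singleton] at h₁
    exact List.suffix_or_suffix_of_suffix ⟨s, rfl⟩ ⟨_, h₁⟩

theorem FactorF.exists_desubstitution {p B q : List (Fin 5)} (h : FactorF (p ++ (Fw B ++ q)))
    (hp : p ≠ []) (hq : q ≠ []) (hP : BoundaryF (p ++ Fw B) q) :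
    ∃ x z, FactorF (x :: (B ++ [z])) ∧ LeftOK F p x ∧ RightOK F q z :=
  let ⟨_, hm, hi⟩ := h.exists_flatMap
  delimitedF.exists_desubstitution hm hi hp hq hP

theorem FactorW5.exists_desubstitution {p B q : List (Fin 5)} (h : FactorW5 (p ++ (Hw B ++ q)))
    (hp : p ≠ []) (hq : q ≠ []) (hP : BoundaryH (p ++ Hw B) q) :
    ∃ x z, FactorF (x :: (B ++ [z])) ∧ LeftOK H p x ∧ RightOK H q z :=
  let ⟨_, hm, hi⟩ := h.exists_flatMap
  delimitedH.exists_desubstitution hm hi hp hq hP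

/-! ### Rotations -/

theorem isRotated_iff_exists_append {u v : List (Fin 5)} :
    u ~r v ↔ ∃ s t, u = s ++ t ∧ v = t ++ s := by
  constructor
  · rintro ⟨n, rfl⟩
    exact ⟨_, _, (List.take_append_drop (n % u.length) u).symm,
      List.rotate_eq_drop_append_take_mod⟩
  · rintro ⟨s, t, rfl, rfl⟩
    exact List.isRotated_append

theorem isRotated_flatMap {u v : List (Fin 5)} (f : Fin 5 → List (Fin 5)) (h : u ~r v) :
    u.flatMap f ~r v.flatMap f := by
  obtain ⟨s, t, rfl, rfl⟩ := isRotated_iff_exists_append.1 h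
  simpa using List.isRotated_append

/-! ### Six families of classes that are not contained in the language -/

/-- Cyclic words with a rotation that is not a factor of the fixed point of `F`, the defect being
of a kind that persists under `F`. -/
inductive Defective (V : List (Fin 5)) : Prop
  | two {B} : V ~r 2 :: B → [3] <+: B → [3] <:+ B → ¬ FactorF (2 :: (B ++ [2])) → Defective V
  | three {B} : V ~r 3 :: B → [2] <+: B ∨ [0] <+: B → [0] <:+ B → ¬ FactorF (3 :: (B ++ [3])) →
      Defective V
  | four {B} : V ~r 4 :: B → [0] <+: B → [1, 2] <:+ B → ¬ FactorF (4 :: (B ++ [4])) →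
      Defective V
  | twoOne {B} : V ~r 2 :: (B ++ [1]) → ¬ FactorF (2 :: (B ++ [1])) → Defective V
  | zero {B} : V ~r 0 :: B → [2] <:+ B → ¬ FactorF (0 :: (B ++ [0])) → Defective V
  | oneZero {B} : V ~r 1 :: (B ++ [0]) → ¬ FactorF (1 :: (B ++ [0])) → Defective V

theorem FactorF.elim {u v : List (Fin 5)} (hv : FactorF v) (h : u <:+: v) (hu : u.length ≤ 5)
    (hs : ¬ u <:+: sample) : False :=
  hs ((hv.of_infix h).infix_sample hu)

theorem Defective.map {V : List (Fin 5)} (hV : Defective V) : Defective (Fw V) := by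
  cases hV with
  | @two B hr h₁ h₂ hn =>
    have hr' := isRotated_flatMap F hr
    obtain ⟨t, rfl⟩ := h₁
    refine .three (B := Fw ([3] ++ t) ++ [0]) (hr'.trans ?_) (by simp [Fw, F]) (by simp) fun h => ?_
    · exact List.isRotated_append (l := [0]) (l' := 3 :: Fw ([3] ++ t))
    · obtain ⟨x, z, hf, hx, hz⟩ := FactorF.exists_desubstitution (p := [3]) (B := [3] ++ t)
        (q := [0, 3]) (by simpa using h) (by simp) (by simp) (by simp [BoundaryF])
      obtain ⟨rfl | rfl, rfl⟩ := (by decide : ∀ x z, LeftOK F [3] x → RightOK F [0, 3] z →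
        (x = 2 ∨ x = 4) ∧ z = 2) x z hx hz
      · exact hn hf
      · exact hf.elim (u := [4, 3]) ⟨[], _, rfl⟩ (by decide) (by decide)
  | @three B hr h₁ h₂ hn =>
    have hr' := isRotated_flatMap F hr
    refine .four (B := Fw B ++ [2]) (hr'.trans ?_) ?_ ?_ fun h => ?_
    · exact List.isRotated_append (l := [2]) (l' := 4 :: Fw B)
    · rcases h₁ with ⟨t, rfl⟩ | ⟨t, rfl⟩ <;> simp [Fw, F]
    · obtain ⟨t, rfl⟩ := h₂
      exact ⟨Fw t ++ [0], by simp [Fw, F]⟩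
    · obtain ⟨x, z, hf, hx, hz⟩ := FactorF.exists_desubstitution (p := [4]) (B := B)
        (q := [2, 4]) (by simpa using h) (by simp) (by simp) (by simp [BoundaryF])
      obtain ⟨rfl, rfl⟩ := (by decide : ∀ x z, LeftOK F [4] x → RightOK F [2, 4] z →
        x = 3 ∧ z = 3) x z hx hz
      exact hn hf
  | @four B hr h₁ h₂ hn =>
    have hr' := isRotated_flatMap F hr
    refine .two (B := 3 :: Fw B) (hr'.trans ?_) (by simp) ?_ fun h => ?_
    · exact List.IsRotated.refl _
    · obtain ⟨t, rfl⟩ := h₂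
      exact ⟨3 :: (Fw t ++ [2, 0]), by simp [Fw, F]⟩
    · obtain ⟨x, z, hf, hx, hz⟩ := FactorF.exists_desubstitution (p := [2, 3]) (B := B)
        (q := [2]) (by simpa using h) (by simp) (by simp) (by simp [BoundaryF])
      obtain ⟨rfl, rfl | rfl | rfl⟩ := (by decide : ∀ x z, LeftOK F [2, 3] x → RightOK F [2] z →
        x = 4 ∧ (z = 1 ∨ z = 3 ∨ z = 4)) x z hx hz
      · obtain ⟨t, rfl⟩ := h₂
        exact hf.elim (u := [1, 2, 1]) ⟨4 :: t, [], by simp⟩ (by decide) (by decide)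
      · obtain ⟨t, rfl⟩ := h₂
        exact hf.elim (u := [1, 2, 3]) ⟨4 :: t, [], by simp⟩ (by decide) (by decide)
      · exact hn hf
  | @twoOne B hr hn =>
    have hr' := isRotated_flatMap F hr
    refine .zero (B := 3 :: (Fw B ++ [2])) (hr'.trans ?_) ⟨3 :: Fw B, rfl⟩ fun h => ?_
    · simp [Fw, F, List.IsRotated.refl]
    · obtain ⟨x, z, hf, hx, hz⟩ := FactorF.exists_desubstitution (p := [0, 3]) (B := B)
        (q := [2, 0]) (by simpa using h) (by simp) (by simp) (by simp [BoundaryF])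
      obtain ⟨rfl, rfl⟩ := (by decide : ∀ x z, LeftOK F [0, 3] x → RightOK F [2, 0] z →
        x = 2 ∧ z = 1) x z hx hz
      exact hn hf
  | @zero B hr h₁ hn =>
    have hr' := isRotated_flatMap F hr
    refine .oneZero (B := Fw B) (hr'.trans ?_) fun h => ?_
    · exact List.isRotated_append (l := [0]) (l' := 1 :: Fw B)
    · obtain ⟨x, z, hf, hx, hz⟩ := FactorF.exists_desubstitution (p := [1]) (B := B)
        (q := [0]) (by simpa using h) (by simp) (by simp) (by simp [BoundaryF])
      obtain ⟨rfl, rfl | rfl⟩ := (by decide : ∀ x z, LeftOK F [1] x → RightOK F [0] z →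
        x = 0 ∧ (z = 0 ∨ z = 2)) x z hx hz
      · exact hn hf
      · obtain ⟨t, rfl⟩ := h₁
        exact hf.elim (u := [2, 2]) ⟨0 :: t, [], by simp⟩ (by decide) (by decide)
  | @oneZero B hr hn =>
    have hr' := isRotated_flatMap F hr
    refine .twoOne (B := Fw B ++ [0]) (hr'.trans ?_) fun h => ?_
    · simp [Fw, F, List.IsRotated.refl]
    · obtain ⟨x, z, hf, hx, hz⟩ := FactorF.exists_desubstitution (p := [2]) (B := B)
        (q := [0, 1]) (by simpa using h) (by simp) (by simp) (by simp [BoundaryF])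
      obtain ⟨rfl, rfl⟩ := (by decide : ∀ x z, LeftOK F [2] x → RightOK F [0, 1] z →
        x = 1 ∧ z = 0) x z hx hz
      exact hn hf

theorem Defective.exists_not_factorW5 {V : List (Fin 5)} (hV : Defective V) :
    ∃ N, N ~r Hw V ∧ ¬ FactorW5 N := by
  have rot : ∀ {W N : List (Fin 5)} (X Y : List (Fin 5)), V ~r W → Hw W = X ++ Y → N = Y ++ X →
      N ~r Hw V := by
    rintro W _ X Y h e rfl
    exact List.isRotated_append.trans (e ▸ (isRotated_flatMap H h).symm)
  cases hV with
  | @two B hr h₁ h₂ hn =>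
    refine ⟨[4, 2, 3] ++ (Hw B ++ [0, 1, 2, 3, 1]), ?_, fun h => ?_⟩
    · exact rot [0, 1, 2, 3, 1] ([4, 2, 3] ++ Hw B) hr rfl (by simp)
    · obtain ⟨x, z, hf, hx, hz⟩ :=
        h.exists_desubstitution (by simp) (by simp) (by simp [BoundaryH])
      obtain ⟨rfl | rfl, rfl⟩ := (by decide : ∀ x z, LeftOK H [4, 2, 3] x →
        RightOK H [0, 1, 2, 3, 1] z → (x = 2 ∨ x = 4) ∧ z = 2) x z hx hz
      · exact hn hf
      · obtain ⟨t, rfl⟩ := h₁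
        exact hf.elim (u := [4, 3]) ⟨[], _, rfl⟩ (by decide) (by decide)
  | @three B hr h₁ h₂ hn =>
    refine ⟨[4] ++ (Hw B ++ [4, 0, 2, 3, 1]), ?_, fun h => ?_⟩
    · exact rot [4, 0, 2, 3, 1] ([4] ++ Hw B) hr rfl (by simp)
    · obtain ⟨x, z, hf, hx, hz⟩ :=
        h.exists_desubstitution (by simp) (by simp) (by simp [BoundaryH])
      obtain ⟨rfl, rfl | rfl⟩ := (by decide : ∀ x z, LeftOK H [4] x →
        RightOK H [4, 0, 2, 3, 1] z → x = 3 ∧ (z = 3 ∨ z = 4)) x z hx hz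
      · exact hn hf
      · obtain ⟨t, rfl⟩ := h₂
        exact hf.elim (u := [0, 4]) ⟨3 :: t, [], by simp⟩ (by decide) (by decide)
  | @four B hr h₁ h₂ hn =>
    obtain ⟨t, rfl⟩ := h₂
    refine ⟨[0, 2, 3, 1, 4, 2, 3] ++ (Hw (t ++ [1, 2]) ++ [4]), ?_, fun h => ?_⟩
    · exact rot [4] ([0, 2, 3, 1, 4, 2, 3] ++ Hw (t ++ [1, 2])) hr rfl (by simp)
    · obtain ⟨x, z, hf, hx, hz⟩ := h.exists_desubstitution (by simp) (by simp)
        (Or.inr (Or.inr ⟨⟨[0, 2, 3, 1, 4, 2, 3] ++ Hw (t ++ [1]) ++ [0, 1, 2, 3, 1, 4, 2],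
          by simp [Hw, H, F, Gw, G]⟩, by simp⟩))
      obtain ⟨rfl, rfl | rfl | rfl⟩ := (by decide : ∀ x z, LeftOK H [0, 2, 3, 1, 4, 2, 3] x →
        RightOK H [4] z → x = 4 ∧ (z = 1 ∨ z = 3 ∨ z = 4)) x z hx hz
      · exact hf.elim (u := [1, 2, 1]) ⟨4 :: t, [], by simp⟩ (by decide) (by decide)
      · exact hf.elim (u := [1, 2, 3]) ⟨4 :: t, [], by simp⟩ (by decide) (by decide)
      · exact hn hf
  | @twoOne B hr hn =>
    refine ⟨[1, 2, 3, 1, 4, 2, 3] ++ (Hw B ++ [4, 0, 2, 3, 0]), ?_, fun h => ?_⟩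
    · exact rot [0] ([1, 2, 3, 1, 4, 2, 3] ++ Hw B ++ [4, 0, 2, 3]) hr
        (by simp [Hw, H, F, Gw, G]) (by simp)
    · obtain ⟨x, z, hf, hx, hz⟩ :=
        h.exists_desubstitution (by simp) (by simp) (by simp [BoundaryH])
      obtain ⟨rfl, rfl⟩ := (by decide : ∀ x z, LeftOK H [1, 2, 3, 1, 4, 2, 3] x →
        RightOK H [4, 0, 2, 3, 0] z → x = 2 ∧ z = 1) x z hx hz
      exact hn hf
  | @zero B hr h₁ hn =>
    obtain ⟨t, rfl⟩ := h₁
    refine ⟨[1, 2, 3] ++ (Hw (t ++ [2]) ++ [0]), ?_, fun h => ?_⟩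
    · exact rot [0] ([1, 2, 3] ++ Hw (t ++ [2])) hr rfl (by simp)
    · obtain ⟨x, z, hf, hx, hz⟩ := h.exists_desubstitution (by simp) (by simp)
        (Or.inr (Or.inr ⟨⟨[1, 2, 3] ++ Hw t ++ [0, 1, 2, 3, 1, 4, 2],
          by simp [Hw, H, F, Gw, G]⟩, by simp⟩))
      obtain ⟨rfl, rfl | rfl⟩ := (by decide : ∀ x z, LeftOK H [1, 2, 3] x →
        RightOK H [0] z → x = 0 ∧ (z = 0 ∨ z = 2)) x z hx hz
      · exact hn hf
      · exact hf.elim (u := [2, 2]) ⟨0 :: t, [], by simp⟩ (by decide) (by decide)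
  | @oneZero B hr hn =>
    refine ⟨[0, 2, 3] ++ (Hw B ++ [0, 1, 2, 3, 4]), ?_, fun h => ?_⟩
    · exact rot [4] ([0, 2, 3] ++ Hw B ++ [0, 1, 2, 3]) hr
        (by simp [Hw, H, F, Gw, G]) (by simp)
    · obtain ⟨x, z, hf, hx, hz⟩ :=
        h.exists_desubstitution (by simp) (by simp) (by simp [BoundaryH])
      obtain ⟨rfl, rfl⟩ := (by decide : ∀ x z, LeftOK H [0, 2, 3] x →
        RightOK H [0, 1, 2, 3, 4] z → x = 1 ∧ z = 0) x z hx hz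
      exact hn hf

/-! ### Cyclic words with all long enough proper factors in a language -/

/-- In every rotation of `V`, the prefixes obtained by removing at least `k` letters are in `L`. -/
def Cyclic (L : List (Fin 5) → Prop) (k : ℕ) (V : List (Fin 5)) : Prop :=
  ∀ X Y, X ++ Y ~r V → k ≤ Y.length → L X

theorem Cyclic.of_isRotated {L : List (Fin 5) → Prop} {k : ℕ} {V W : List (Fin 5)}
    (h : Cyclic L k V) (r : V ~r W) : Cyclic L k W :=
  fun X Y e hY => h X Y (e.trans r.symm) hY

theorem Cyclic.mono {L : List (Fin 5) → Prop} {k l : ℕ} {V : List (Fin 5)}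
    (h : Cyclic L k V) (hkl : k ≤ l) : Cyclic L l V :=
  fun X Y e hY => h X Y e (hkl.trans hY)

theorem Cyclic.of_prefix {L : List (Fin 5) → Prop} {k : ℕ} {C D X : List (Fin 5)}
    (h : Cyclic L k C) (hD : D ~r C) (hX : X <+: D) (hk : X.length + k ≤ C.length) : L X := by
  obtain ⟨Y, rfl⟩ := hX
  have := hD.perm.length_eq
  rw [List.length_append] at this
  exact h X Y hD (by omega)

theorem Cyclic.of_infix {L : List (Fin 5) → Prop} {k : ℕ} {C X : List (Fin 5)}
    (h : Cyclic L k C) (hX : X <:+: C ++ C) (hk : X.length + k ≤ C.length) : L X := by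
  obtain ⟨s, t, e⟩ := hX
  rw [List.append_assoc] at e
  rcases List.append_eq_append_iff.1 e with ⟨Z, rfl, e'⟩ | ⟨Y, rfl, e'⟩
  · refine h.of_prefix (D := Z ++ s) List.isRotated_append ?_ hk
    refine List.prefix_of_prefix_length_le ⟨t, e'⟩ ⟨Z, by simp⟩ ?_
    simp only [List.length_append] at *
    omega
  · refine h.of_prefix (D := (X ++ t) ++ Y) ?_ (by simp) hk
    rw [e']
    exact List.isRotated_append

theorem Delimited.exists_isRotated_flatMap {f : Fin 5 → List (Fin 5)}
    {P : List (Fin 5) → List (Fin 5) → Prop} (h : Delimited f P) {L : List (Fin 5) → Prop}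
    {k n : ℕ} {S C : List (Fin 5)} (hC : Cyclic L k C) (hn : n + k ≤ C.length)
    (hL : ∀ u, L u → u.length ≤ n → u <:+: S) (hP : ∀ Z, P [] Z → P [] (Z.take n))
    (starts : ∀ y ∈ windows n S, y.length = n → ∃ i ∈ List.range n, P [] (y.drop i))
    (token : ∀ y ∈ windows n S, y.length = n → P [] y →
      ∃ a, f a <+: y ∧ P [] (y.drop (f a).length)) :
    ∃ V : List (Fin 5), C ~r V.flatMap f := by
  have window : ∀ {D}, Cyclic L k D → n + k ≤ D.length → ∀ {Z}, Z <:+ D ++ D → n ≤ Z.length →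
      Z.take n ∈ windows n S ∧ (Z.take n).length = n := by
    intro D hD hn Z hZ hlen
    have hl : (Z.take n).length = n := by simpa using hlen
    have hLZ : L (Z.take n) :=
      hD.of_infix ((List.take_prefix _ _).isInfix.trans hZ.isInfix) (by omega)
    obtain ⟨y, hy, hp⟩ := exists_mem_windows (hL _ hLZ hl.le) hl.le
    have hyl := length_le_of_mem_windows hy
    rw [hp.eq_of_length_le (by omega)]
    exact ⟨hy, by have := hp.length_le; omega⟩
  obtain ⟨D, hr, hD⟩ : ∃ D, C ~r D ∧ P [] D := by
    obtain ⟨hw, hl⟩ := window hC hn (List.suffix_append C C) (by omega)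
    obtain ⟨i, -, hi⟩ := starts _ hw hl
    refine ⟨C.drop i ++ C.take i, ?_, ?_⟩
    · simpa using List.isRotated_append (l := C.take i) (l' := C.drop i)
    · rw [List.drop_take] at hi
      have := h.mono [] [] _ ((C.drop i).drop (n - i) ++ C.take i) hi
      rwa [← List.append_assoc, List.take_append_drop] at this
  have hCD := hr.perm.length_eq
  have hD' := hC.of_isRotated hr
  obtain ⟨V, rfl⟩ := h.exists_flatMap_eq hD fun Z hZ hlen hPZ => by
    obtain ⟨hw, hl⟩ := window hD' (by omega) hZ (by omega)
    obtain ⟨a, ⟨t, e⟩, ha⟩ := token _ hw hl (hP Z hPZ)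
    refine ⟨a, t ++ Z.drop n, ?_, ?_⟩
    · rw [← List.append_assoc, e, List.take_append_drop]
    · rw [← e, List.drop_left] at ha
      simpa using h.mono [] [] t (Z.drop n) ha
  exact ⟨V, hr⟩

theorem Delimited.factorF_of_infix_flatMap {f : Fin 5 → List (Fin 5)}
    {P : List (Fin 5) → List (Fin 5) → Prop} (h : Delimited f P) {m B q : List (Fin 5)}
    (hm : FactorF m) (hi : B.flatMap f ++ q <:+: m.flatMap f) (hP : P (B.flatMap f) q) :
    FactorF B := by
  obtain ⟨s, t, e⟩ := hi
  have e' : m.flatMap f = s ++ (B.flatMap f ++ (q ++ t)) := by simp [← e]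
  obtain ⟨m₁, m₂, rfl, -, -⟩ := h.exists_split_middle e' (h.mono s _ _ t hP)
  exact hm.of_infix ⟨m₁, m₂, by simp⟩

theorem Cyclic.exists_isRotated_Hw {C : List (Fin 5)} (hC : Cyclic FactorW5 0 C)
    (hlen : 11 ≤ C.length) : ∃ V, C ~r Hw V ∧ Cyclic FactorF 1 V := by
  obtain ⟨V, hr⟩ := delimitedH.exists_isRotated_flatMap (n := 11) (S := Hw sample) hC hlen
    (fun u hu hl => hu.infix_sample (by omega))
    (by
      rintro Z (⟨t, rfl⟩ | ⟨t, rfl⟩ | ⟨h, -⟩)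
      · simp [BoundaryH]
      · simp [BoundaryH]
      · simp at h)
    (by decide +kernel) (by decide +kernel)
  refine ⟨V, hr, fun X Y e hY => ?_⟩
  obtain _ | ⟨a, Y⟩ := Y
  · simp at hY
  have e' := (isRotated_flatMap H e).trans hr.symm
  obtain ⟨m, hm, hi⟩ := FactorW5.exists_flatMap (hC (X.flatMap H ++ H a) (Y.flatMap H)
    (by simpa using e') (by simp))
  exact delimitedH.factorF_of_infix_flatMap hm hi
    (by simpa using delimitedH.start (X.flatMap H) a [])

theorem length_lt_length_Fw (W : List (Fin 5)) :
    W.length < (Fw W).length ∨ W.length = (Fw W).length ∧ ∀ x ∈ Fw W, x = 2 := by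
  induction W with
  | nil => simp [Fw]
  | cons a W ih =>
    have ha : 2 ≤ (F a).length ∨ (F a).length = 1 ∧ ∀ x ∈ F a, x = 2 := by decide +revert
    simp only [Fw, List.flatMap_cons, List.length_cons, List.length_append, List.mem_append] at *
    grind

theorem length_Fw_le (W : List (Fin 5)) : (Fw W).length ≤ 2 * W.length := by
  induction W with
  | nil => simp [Fw]
  | cons a W ih =>
    have ha : (F a).length ≤ 2 := by decide +revert
    simp only [Fw, List.flatMap_cons, List.length_cons, List.length_append] at *
    omega

theorem Cyclic.exists_isRotated_Fw {V : List (Fin 5)} (hV : Cyclic FactorF 2 V)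
    (hlen : 6 ≤ V.length) :
    ∃ W, V ~r Fw W ∧ Cyclic FactorF 2 W ∧ W.length < V.length ∧ V.length ≤ 2 * W.length := by
  obtain ⟨W, hr⟩ := delimitedF.exists_isRotated_flatMap (n := 4) (S := sample) hV hlen
    (fun u hu hl => hu.infix_sample (by omega))
    (by rintro Z (⟨t, rfl⟩ | ⟨t, rfl⟩) <;> simp [BoundaryF])
    (by decide +kernel) (by decide +kernel)
  have hr' : V ~r Fw W := hr
  have h22 : ∀ t, ¬ 2 :: 2 :: t ~r V := by
    intro t ht
    have := hV.of_prefix (X := [2, 2]) ht (by simp) (by simp; omega)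
    exact this.elim List.infix_rfl (by decide) (by decide)
  refine ⟨W, hr', fun X Y e hY => ?_, ?_, ?_⟩
  · have e' : Fw X ++ Fw Y ~r V := by
      simpa [Fw] using (isRotated_flatMap F e).trans hr.symm
    obtain _ | ⟨a, _ | ⟨b, Y⟩⟩ := Y
    · simp at hY
    · simp at hY
    have key : ∀ a b, F a ++ F b = [2, 2] ∨
        BoundaryF [] ((F a ++ F b).take 1) ∧ 2 ≤ ((F a ++ F b).drop 1).length := by decide
    have hab : Fw (a :: b :: Y) = (F a ++ F b) ++ Fw Y := by simp [Fw]
    rw [hab] at e'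
    rcases key a b with hl | ⟨ht, hl⟩
    · refine absurd ?_ (h22 (Fw Y ++ Fw X))
      refine List.IsRotated.trans ?_ e'
      refine List.IsRotated.trans ?_ List.isRotated_append
      simp [hl, List.IsRotated.refl]
    · rw [← List.take_append_drop 1 (F a ++ F b)] at e'
      obtain ⟨m, hm, hi⟩ := FactorF.exists_flatMap (hV (Fw X ++ (F a ++ F b).take 1)
        ((F a ++ F b).drop 1 ++ Fw Y) (by simpa only [List.append_assoc] using e')
        (by rw [List.length_append]; omega))
      exact delimitedF.factorF_of_infix_flatMap hm hi ht
  · rw [hr'.perm.length_eq]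
    refine (length_lt_length_Fw W).resolve_right ?_
    rintro ⟨-, h⟩
    have hl := hr'.perm.length_eq
    rcases hW : Fw W with _ | ⟨x, _ | ⟨y, t⟩⟩
    · rw [hW, List.length_nil] at hl
      omega
    · rw [hW, List.length_singleton] at hl
      omega
    · obtain rfl : x = 2 := h x (by simp [hW])
      obtain rfl : y = 2 := h y (by simp [hW])
      exact h22 t (hW ▸ hr'.symm)
  · rw [hr'.perm.length_eq]
    exact length_Fw_le W

/-! ### Short cyclic words -/

/-- The words of length `n` all of whose factors of length at most `m` occur in `sample`. -/
def paths (m : ℕ) : ℕ → List (List (Fin 5))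
  | 0 => [[]]
  | n + 1 => ((paths m n).flatMap fun w => (List.finRange 5).map (· :: w)).filter
      fun v => decide (v.take m <:+: sample)

theorem mem_paths {m : ℕ} {V : List (Fin 5)}
    (h : ∀ u, u <:+: V → u.length ≤ m → u <:+: sample) : V ∈ paths m V.length := by
  induction V with
  | nil => simp [paths]
  | cons a V ih =>
    have hV := ih fun u hu => h u (hu.trans (List.suffix_cons a V).isInfix)
    have ha := h _ (List.take_prefix m (a :: V)).isInfix (by simp)
    simp only [List.length_cons, paths, List.mem_filter, List.mem_flatMap, decide_eq_true_eq]
    exact ⟨⟨V, hV, List.mem_map.2 ⟨a, List.mem_finRange a, rfl⟩⟩, ha⟩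

/-- A test that lists the cyclic words of length `n` all of whose cyclic factors of length `m` are
factors of the fixed point of `F`. -/
def OnlyRotationsOf (T : List (List (Fin 5))) (m n : ℕ) : Prop :=
  ∀ V ∈ paths m n, (∃ y ∈ windows m (V ++ V), ¬ y <:+: sample) ∨
    ∃ i ∈ List.range n, V.rotate i ∈ T

instance (T : List (List (Fin 5))) (m n : ℕ) : Decidable (OnlyRotationsOf T m n) :=
  inferInstanceAs (Decidable (∀ V ∈ paths m n, _))

theorem OnlyRotationsOf.exists_isRotated {T : List (List (Fin 5))} {m n k : ℕ}
    (h : OnlyRotationsOf T m n) {V : List (Fin 5)} (hV : Cyclic FactorF k V) (hn : V.length = n)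
    (hm : m + k ≤ n) (hm5 : m ≤ 5) : ∃ t ∈ T, V ~r t := by
  have key : ∀ u, u <:+: V ++ V → u.length ≤ m → u <:+: sample := fun u hu hl =>
    (hV.of_infix hu (by omega)).infix_sample (by omega)
  rcases h V (hn ▸ mem_paths fun u hu => key u (hu.trans (List.prefix_append V V).isInfix)) with
    ⟨y, hy, hn⟩ | ⟨i, -, hi⟩
  · exact absurd (key y (infix_of_mem_windows hy) (length_le_of_mem_windows hy)) hn
  · exact ⟨_, hi, i, rfl⟩

theorem not_factorF {u : List (Fin 5)} (hu : u.length ≤ 5) (h : ¬ u <:+: sample) : ¬ FactorF u :=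
  fun hf => h (hf.infix_sample hu)

theorem Defective.of_isRotated {V W : List (Fin 5)} (hV : Defective V) (r : W ~r V) :
    Defective W := by
  cases hV with
  | two h h₁ h₂ h₃ => exact .two (r.trans h) h₁ h₂ h₃
  | three h h₁ h₂ h₃ => exact .three (r.trans h) h₁ h₂ h₃
  | four h h₁ h₂ h₃ => exact .four (r.trans h) h₁ h₂ h₃
  | twoOne h h₁ => exact .twoOne (r.trans h) h₁
  | zero h h₁ h₂ => exact .zero (r.trans h) h₁ h₂
  | oneZero h h₁ => exact .oneZero (r.trans h) h₁

theorem defective_twoThree : Defective [2, 3] :=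
  .two (B := [3]) (.refl _) (by decide) (by decide) (not_factorF (by decide) (by decide))

theorem defective_threeZero : Defective [3, 0] :=
  .three (B := [0]) (.refl _) (by decide) (by decide) (not_factorF (by decide) (by decide))

theorem defective_twoZeroOne : Defective [2, 0, 1] :=
  .twoOne (B := [0]) (.refl _) (not_factorF (by decide) (by decide))

theorem Cyclic.defective {V : List (Fin 5)} (hV : Cyclic FactorF 2 V) (hlen : 5 ≤ V.length) :
    Defective V := by
  induction h : V.length using Nat.strong_induction_on generalizing V with
  | _ n ih =>
    subst h
    by_cases h7 : 7 ≤ V.length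
    · obtain ⟨W, hr, hW, hlt, hle⟩ := hV.exists_isRotated_Fw (by omega)
      by_cases h5 : 5 ≤ W.length
      · exact (ih _ hlt hW h5 rfl).map.of_isRotated hr
      obtain ⟨t, ht, hrt⟩ := OnlyRotationsOf.exists_isRotated (m := 2) (n := 4)
        (T := [Fw [3, 0], Fw [2, 3], [0, 3, 0, 3], [0, 3, 2, 3], [0, 1, 2, 3], [2, 3, 2, 3]])
        (by decide +kernel) hW (by omega) le_rfl (by decide)
      have hrF := hr.trans (isRotated_flatMap F hrt)
      have hl := hrF.perm.length_eq
      have exclude : (∃ y ∈ windows 5 (Fw t ++ Fw t), ¬ y <:+: sample) → False := fun ⟨y, hy, hn⟩ =>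
        hn (((hV.of_isRotated hrF).of_infix (infix_of_mem_windows hy)
          (by have := length_le_of_mem_windows hy; omega)).infix_sample
            (length_le_of_mem_windows hy))
      simp only [List.mem_cons, List.not_mem_nil, or_false] at ht
      rcases ht with rfl | rfl | rfl | rfl | rfl | rfl
      · exact defective_threeZero.map.map.of_isRotated hrF
      · exact defective_twoThree.map.map.of_isRotated hrF
      all_goals exact (exclude (by decide +kernel)).elim
    obtain h | h : V.length = 5 ∨ V.length = 6 := by omega
    · obtain ⟨t, ht, hr⟩ := OnlyRotationsOf.exists_isRotated (m := 3) (T := [Fw [2, 0, 1]])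
        (by decide +kernel) hV h (by decide) (by decide)
      exact defective_twoZeroOne.map.of_isRotated (List.mem_singleton.1 ht ▸ hr)
    · obtain ⟨t, ht, -⟩ := OnlyRotationsOf.exists_isRotated (m := 4) (T := [])
        (by decide +kernel) hV h (by decide) (by decide)
      simp at ht

/-! ### Cyclic words contained in the language of the coded word -/

theorem length_Hw_le (V : List (Fin 5)) : (Hw V).length ≤ 8 * V.length := by
  induction V with
  | nil => simp [Hw]
  | cons a V ih =>
    have ha : (H a).length ≤ 8 := by decide +revert
    simp only [Hw, List.flatMap_cons, List.length_cons, List.length_append] at *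
    omega

theorem not_cyclic_of_defective {C V : List (Fin 5)} (hC : Cyclic FactorW5 0 C) (hr : C ~r Hw V)
    (hV : Defective V) : False := by
  obtain ⟨N, hN, hn⟩ := hV.exists_not_factorW5
  exact hn (hC N [] (by simpa using hN.trans hr.symm) le_rfl)

theorem not_cyclic_of_le_length {C : List (Fin 5)} (hC : Cyclic FactorW5 0 C)
    (hlen : 11 ≤ C.length) : False := by
  obtain ⟨V, hr, hV⟩ := hC.exists_isRotated_Hw hlen
  have hl := hr.perm.length_eq
  have hV8 := length_Hw_le V
  have elim : ∀ {W}, Defective W → V ~r W → False := fun hW h =>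
    not_cyclic_of_defective hC hr (hW.of_isRotated h)
  obtain h | h | h | h : V.length = 2 ∨ V.length = 3 ∨ V.length = 4 ∨ 5 ≤ V.length := by omega
  · obtain ⟨a, b, rfl⟩ := List.length_eq_two.1 h
    have key : ∀ a b, (∃ y ∈ windows 10 (Hw [a, b] ++ Hw [a, b]), ¬ y <:+: Hw sample) ∨
        [a, b] ~r [2, 3] ∨ [a, b] ~r [3, 0] := by decide +kernel
    rcases key a b with ⟨y, hy, hn⟩ | h | h
    · have hl10 := length_le_of_mem_windows hy
      exact hn (FactorW5.infix_sample ((hC.of_isRotated hr).of_infix (infix_of_mem_windows hy)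
        (by omega)) (by omega))
    · exact elim defective_twoThree h
    · exact elim defective_threeZero h
  · obtain ⟨t, ht, hrt⟩ := OnlyRotationsOf.exists_isRotated (m := 2) (T := [[2, 0, 1], [3, 2, 0]])
      (by decide +kernel) hV h (by simp) (by simp)
    simp only [List.mem_cons, List.not_mem_nil, or_false] at ht
    rcases ht with rfl | rfl
    · exact elim defective_twoZeroOne hrt
    · have hf := hC (H 3 ++ (Hw [2] ++ H 0)) [] (hr.trans (isRotated_flatMap H hrt)).symm le_rfl
      obtain ⟨x, z, hf, hx, hz⟩ :=
        hf.exists_desubstitution (by decide) (by decide) (by decide)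
      obtain ⟨rfl, rfl | rfl⟩ := (by decide : ∀ x z, LeftOK H (H 3) x →
        RightOK H (H 0) z → x = 3 ∧ (z = 0 ∨ z = 2)) x z hx hz
      · exact hf.elim List.infix_rfl (by decide) (by decide)
      · exact hf.elim List.infix_rfl (by decide) (by decide)
  · obtain ⟨t, ht, hrt⟩ := OnlyRotationsOf.exists_isRotated (m := 3)
      (T := [Fw [3, 0], Fw [2, 3]]) (by decide +kernel) hV h (by simp) (by simp)
    simp only [List.mem_cons, List.not_mem_nil, or_false] at ht
    rcases ht with rfl | rfl
    · exact elim defective_threeZero.map hrt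
    · exact elim defective_twoThree.map hrt
  · exact elim ((hV.mono one_le_two).defective h) (.refl _)

/-- A factor of `w₅` with the same factors of length at most ten. -/
def sampleW5 : List (Fin 5) :=
  [3, 0, 1, 2, 3, 1, 4, 2, 3, 4, 0, 2, 3, 1, 4, 2, 3, 0, 1, 2, 3, 4, 0, 2, 3, 0, 1, 2, 3, 1, 4, 2, 3,
    0, 1, 2, 3, 4, 0, 2, 3, 1, 4, 0, 1, 2, 3, 1, 4, 2, 3, 4, 0, 2, 3, 1, 4, 0, 1, 2, 3, 4, 0, 2, 3, 0]

theorem FactorW5.infix_sampleW5 {u : List (Fin 5)} (hu : FactorW5 u) (h10 : u.length ≤ 10) :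
    u <:+: sampleW5 := by
  obtain ⟨y, hy, hp⟩ := exists_mem_windows (hu.infix_sample (by omega)) h10
  have key : ∀ y ∈ windows 10 (Hw sample), y <:+: sampleW5 := by decide +kernel
  exact hp.isInfix.trans (key y hy)

theorem exists_rotate_not_infix_sampleW5 : ∀ n ∈ List.range' 2 9, ∀ y ∈ windows n sampleW5,
    y.length = n → ∃ i ∈ List.range' 1 n, ¬ y.rotate i <:+: sampleW5 := by
  decide +kernel

theorem not_cyclic_of_length_le {C : List (Fin 5)} (hC : Cyclic FactorW5 0 C)
    (h2 : 2 ≤ C.length) (h10 : C.length ≤ 10) : False := by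
  have rot : ∀ i, C.rotate i <:+: sampleW5 := fun i =>
    (hC (C.rotate i) [] (by simp) le_rfl).infix_sampleW5
      (by simp; omega)
  obtain ⟨y, hy, hp⟩ := exists_mem_windows (by simpa using rot 0) le_rfl
  obtain rfl := hp.eq_of_length_le (length_le_of_mem_windows hy)
  obtain ⟨i, -, hi⟩ := exists_rotate_not_infix_sampleW5 _ (by simp; omega) _ hy rfl
  exact hi (rot i)

theorem avoid_conjugacy_classes_w5 :
    ∀ u : List (Fin 5), FactorW5 u → 2 ≤ u.length →
      ∃ v, Conj u v ∧ ¬ FactorW5 v := by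
  intro u _ h2
  by_contra! h
  have hu : Cyclic FactorW5 0 u := fun X Y e _ =>
    (h _ (isRotated_iff_exists_append.1 e.symm)).of_infix (List.prefix_append X Y).isInfix
  rcases le_total u.length 10 with h10 | h10
  · exact not_cyclic_of_length_le hu h2 h10
  · rcases h10.eq_or_lt with h | h
    · exact not_cyclic_of_length_le hu h2 h.ge
    · exact not_cyclic_of_le_length hu h
end

section
/- Every finite word u of length at least 2, all of whose conjugates are factors of the fixed point F^ω(0), is a conjugate of one of the following words: F(2) = 03, F²(2) = 0124, F^d(4) for some d ≥ 1, or f^d(0) for some d ≥ 1, where f = F³. -/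
namespace FactorF

@[simp] lemma Fw_nil : Fw [] = [] := rfl

@[simp] lemma Fw_cons (a : Fin 5) (w : List (Fin 5)) : Fw (a :: w) = F a ++ Fw w := by
  simp [Fw]

@[simp] lemma Fw_append (v w : List (Fin 5)) : Fw (v ++ w) = Fw v ++ Fw w := by
  simp [Fw]

lemma Fw_iterate_append (n : ℕ) (v w : List (Fin 5)) :
    Fw^[n] (v ++ w) = Fw^[n] v ++ Fw^[n] w := by
  induction n generalizing v w with
  | zero => rfl
  | succ n ih => simp [ih]

lemma F_ne_nil (a : Fin 5) : F a ≠ [] := by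
  revert a; decide

lemma Fw_ne_nil {w : List (Fin 5)} (h : w ≠ []) : Fw w ≠ [] := by
  cases w with
  | nil => exact absurd rfl h
  | cons a w => simp [F_ne_nil]

lemma Fw_iterate_ne_nil (n : ℕ) {w : List (Fin 5)} (h : w ≠ []) : Fw^[n] w ≠ [] := by
  induction n generalizing w with
  | zero => exact h
  | succ n ih => exact ih (Fw_ne_nil h)

lemma length_le_length_Fw (w : List (Fin 5)) : w.length ≤ (Fw w).length := by
  induction w with
  | nil => simp
  | cons a w ih =>
    have := List.length_pos_iff.2 (F_ne_nil a)
    simp only [Fw_cons, List.length_append, List.length_cons]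
    omega

lemma mono {u w : List (Fin 5)} (h : FactorF w) (huw : u <:+: w) : FactorF u :=
  let ⟨n, hn⟩ := h
  ⟨n, huw.trans hn⟩

lemma of_append {w : List (Fin 5)} (s t : List (Fin 5)) (h : FactorF (s ++ w ++ t)) :
    FactorF w :=
  h.mono ⟨s, t, rfl⟩

lemma image {w : List (Fin 5)} (h : FactorF w) : FactorF (Fw w) := by
  obtain ⟨n, s, t, h⟩ := h
  refine ⟨n + 1, Fw s, Fw t, ?_⟩
  rw [Function.iterate_succ_apply', ← h]
  simp

/-- Every factor occurs in the image of a factor. -/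
lemma exists_image {w : List (Fin 5)} (h : FactorF w) :
    ∃ v, FactorF v ∧ w <:+: Fw v := by
  obtain ⟨n, h⟩ := h
  cases n with
  | zero => exact ⟨[0], ⟨0, List.infix_rfl⟩, h.trans ⟨[], [1], rfl⟩⟩
  | succ n =>
    rw [Function.iterate_succ_apply'] at h
    exact ⟨_, ⟨n, List.infix_rfl⟩, h⟩

/-- Every factor extends by one letter on both sides. -/
lemma exists_extension {w : List (Fin 5)} (h : FactorF w) :
    ∃ a b, FactorF (a :: w ++ [b]) := by
  obtain ⟨n, s, t, h⟩ := h
  have key : Fw^[n + 3] [0] = Fw^[n] [0, 1, 2] ++ Fw^[n] [0] ++ Fw^[n] [3] := by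
    rw [Function.iterate_add_apply, ← Fw_iterate_append, ← Fw_iterate_append]
    rfl
  obtain ⟨p, a, hp⟩ := List.eq_nil_or_concat (Fw^[n] [0, 1, 2] ++ s) |>.resolve_left
    (by simp [Fw_iterate_ne_nil])
  obtain ⟨b, q, hq⟩ := List.exists_cons_of_ne_nil
    (show t ++ Fw^[n] [3] ≠ [] by simp [Fw_iterate_ne_nil])
  refine ⟨a, b, n + 3, p, q, ?_⟩
  rw [key, ← h]
  calc p ++ (a :: w ++ [b]) ++ q = (p ++ [a]) ++ w ++ (b :: q) := by simp
    _ = _ := by rw [← hq, ← List.concat_eq_append, ← hp]; simp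

/-- The two-letter words that may occur in the fixed point. -/
def Succ (a b : Fin 5) : Prop :=
  (a, b) ∈ [((0 : Fin 5), (1 : Fin 5)), (0, 3), (1, 2), (2, 0), (2, 3), (2, 4), (3, 0), (3, 2),
    (4, 0)]

instance : DecidableRel Succ := fun a b => by unfold Succ; infer_instance

lemma isChain_Fw {w : List (Fin 5)} (h : w.IsChain Succ) : (Fw w).IsChain Succ := by
  have hF : ∀ a, (F a).IsChain Succ := by decide
  have hFF : ∀ a b, Succ a b → ∀ x ∈ (F a).getLast?, ∀ y ∈ (F b).head?, Succ x y := by decide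
  induction w with
  | nil => exact List.isChain_nil
  | cons a w ih =>
    cases w with
    | nil => simpa using hF a
    | cons b w =>
      rw [List.isChain_cons_cons] at h
      rw [Fw_cons]
      refine (hF a).append (ih h.2) fun x hx y hy => hFF a b h.1 x hx y ?_
      rwa [Fw_cons, List.head?_append_of_ne_nil _ (F_ne_nil b)] at hy

lemma isChain {w : List (Fin 5)} (h : FactorF w) : w.IsChain Succ := by
  obtain ⟨n, h⟩ := h
  refine List.IsChain.infix ?_ h
  clear h
  induction n with
  | zero => exact List.isChain_singleton 0
  | succ n ih => rw [Function.iterate_succ_apply']; exact isChain_Fw ih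

lemma succ {a b : Fin 5} (s t : List (Fin 5)) (h : FactorF (s ++ [a, b] ++ t)) : Succ a b := by
  simpa using (h.of_append s t).isChain

/-- A nonempty word beginning with the first letter of a block `F a`. -/
def Start (w : List (Fin 5)) : Prop := ∃ b s, w = b :: s ∧ (b = 0 ∨ b = 2)

lemma start_cons {b : Fin 5} {s : List (Fin 5)} : Start (b :: s) ↔ b = 0 ∨ b = 2 := by
  simp [Start]

lemma Start.append {w : List (Fin 5)} (h : Start w) (t : List (Fin 5)) : Start (w ++ t) := by
  obtain ⟨b, s, rfl, hb⟩ := h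
  exact ⟨b, s ++ t, rfl, hb⟩

lemma start_Fw {w : List (Fin 5)} (h : w ≠ []) : Start (Fw w) := by
  have hF : ∀ a, (F a).head? = some 0 ∨ (F a).head? = some 2 := by decide
  obtain ⟨a, w, rfl⟩ := List.exists_cons_of_ne_nil h
  obtain ⟨b, s, hb⟩ := List.exists_cons_of_ne_nil (F_ne_nil a)
  have := hF a
  rw [hb] at this
  exact ⟨b, s ++ Fw w, by simp [hb], by simpa using this⟩

lemma Fw_injective : Function.Injective Fw := by
  have key : ∀ (c : Fin 5) (v s : List (Fin 5)), Fw v = c :: s → c = 0 ∨ c = 2 := by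
    intro c v s h
    have hv : v ≠ [] := by rintro rfl; simp at h
    have := start_Fw hv
    rwa [h, start_cons] at this
  intro v
  induction v with
  | nil =>
    intro w h
    by_contra hw
    exact Fw_ne_nil (Ne.symm hw) h.symm
  | cons a v ih =>
    intro w h
    cases w with
    | nil => exact absurd h (Fw_ne_nil (by simp))
    | cons b w =>
      rw [Fw_cons, Fw_cons] at h
      have h3 := key 3
      have h4 := key 4
      fin_cases a <;> fin_cases b <;> simp [F] at h ⊢ <;>
        first
          | exact ih h
          | exact absurd (h3 _ _ h) (by decide)
          | exact absurd (h4 _ _ h) (by decide)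
          | exact absurd (h3 _ _ h.symm) (by decide)
          | exact absurd (h4 _ _ h.symm) (by decide)

/-- Block boundaries are exactly the positions in front of the letters `0` and `2`. -/
lemma exists_split {v p r : List (Fin 5)} (h : Fw v = p ++ r) (hr : Start r) :
    ∃ v₁ v₂, v = v₁ ++ v₂ ∧ Fw v₁ = p ∧ Fw v₂ = r := by
  have hF : ∀ a, F a = [2] ∨ ∃ b c, F a = [b, c] ∧ ¬ (c = 0 ∨ c = 2) := by decide
  induction v generalizing p with
  | nil =>
    obtain ⟨b, s, rfl, -⟩ := hr
    simp at h
  | cons a v ih =>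
    rcases p with _ | ⟨c, p⟩
    · exact ⟨[], a :: v, rfl, rfl, h⟩
    rw [Fw_cons] at h
    rcases hF a with ha | ⟨b, d, ha, hd⟩
    · simp only [ha, List.cons_append, List.nil_append, List.cons.injEq] at h
      obtain ⟨v₁, v₂, rfl, rfl, rfl⟩ := ih h.2
      exact ⟨a :: v₁, v₂, rfl, by simp [ha, h.1], rfl⟩
    · rcases p with _ | ⟨e, p⟩
      · simp only [ha, List.cons_append, List.nil_append, List.cons.injEq] at h
        rw [← h.2, start_cons] at hr
        exact absurd hr hd
      · simp only [ha, List.cons_append, List.nil_append, List.cons.injEq] at h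
        obtain ⟨v₁, v₂, rfl, rfl, rfl⟩ := ih h.2.2
        exact ⟨a :: v₁, v₂, rfl, by simp [ha, h.1, h.2.1], rfl⟩

lemma exists_desubstitution_s1 {l x r : List (Fin 5)} (h : FactorF (l ++ x ++ r))
    (hx : Start (x ++ r)) (hr : Start r) :
    ∃ v₁ y v₂, FactorF (v₁ ++ y ++ v₂) ∧ Fw y = x ∧ l <:+ Fw v₁ ∧ r <+: Fw v₂ := by
  obtain ⟨v, hv, s, t, e⟩ := h.exists_image
  have e₁ : Fw v = (s ++ l) ++ ((x ++ r) ++ t) := by simp [← e]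
  obtain ⟨v₁, v', rfl, h₁, h'⟩ := exists_split e₁ (hx.append t)
  rw [List.append_assoc] at h'
  obtain ⟨y, v₂, rfl, hy, h₂⟩ := exists_split h' (hr.append t)
  exact ⟨v₁, y, v₂, by simpa using hv, hy, ⟨s, h₁.symm⟩, ⟨t, h₂.symm⟩⟩

/-- The word `l` can stand immediately before a block boundary that ends the block `F a`. -/
def EndsBlock (l : List (Fin 5)) (a : Fin 5) : Prop := l <:+ F a ∨ F a <:+ l

/-- The word `r` can stand immediately after a block boundary at which the block `F b` begins. -/
def BeginsBlock (r : List (Fin 5)) (b : Fin 5) : Prop :=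
  (r <+: F b ∨ F b <+: r) ∧ ∀ c ∈ (r.drop (F b).length).head?, c = 0 ∨ c = 2

instance (l : List (Fin 5)) : DecidablePred (EndsBlock l) := fun a => by
  unfold EndsBlock; infer_instance

instance (r : List (Fin 5)) : DecidablePred (BeginsBlock r) := fun b => by
  unfold BeginsBlock; infer_instance

lemma exists_desubstitution_letters {l x r : List (Fin 5)} (h : FactorF (l ++ x ++ r))
    (hl : l ≠ []) (hx : Start (x ++ r)) (hr : Start r) :
    ∃ a y b, FactorF (a :: y ++ [b]) ∧ Fw y = x ∧ EndsBlock l a ∧ BeginsBlock r b := by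
  obtain ⟨v₁, y, v₂, hv, hy, h₁, h₂⟩ := exists_desubstitution_s1 h hx hr
  have hv₁ : v₁ ≠ [] := by rintro rfl; exact hl (by simpa using h₁)
  have hv₂ : v₂ ≠ [] := by
    rintro rfl
    obtain ⟨b, s, rfl, -⟩ := hr
    simp at h₂
  obtain ⟨v₁, a, rfl⟩ := (List.eq_nil_or_concat v₁).resolve_left hv₁
  obtain ⟨b, v₂, rfl⟩ := List.exists_cons_of_ne_nil hv₂
  refine ⟨a, y, b, of_append v₁ v₂ (by simpa using hv), hy, ?_, ?_, ?_⟩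
  · exact List.suffix_or_suffix_of_suffix h₁ ⟨Fw v₁, by simp⟩
  · exact List.prefix_or_prefix_of_prefix h₂ ⟨Fw v₂, by simp⟩
  · intro c hc
    rw [Fw_cons] at h₂
    have h₃ := h₂.drop (F b).length
    rw [List.drop_left] at h₃
    obtain ⟨r', hr'⟩ := List.head?_eq_some_iff.1 hc
    rw [hr'] at h₃
    obtain ⟨t, ht⟩ := h₃
    have hv₂ : v₂ ≠ [] := by rintro rfl; simp at ht
    have := start_Fw hv₂
    rwa [← ht, List.cons_append, start_cons] at this

/-- Desubstitution of a word whose central part is known to be an image. -/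
lemma desubstitute {l y r : List (Fin 5)} (h : FactorF (l ++ Fw y ++ r))
    (hl : l ≠ []) (hr : Start r) :
    ∃ a b, FactorF (a :: y ++ [b]) ∧ EndsBlock l a ∧ BeginsBlock r b := by
  have hx : Start (Fw y ++ r) := by
    rcases eq_or_ne y [] with rfl | hy
    · exact hr
    · exact (start_Fw hy).append r
  obtain ⟨a, y', b, h, e, ha, hb⟩ := h.exists_desubstitution_letters hl hx hr
  rw [Fw_injective e] at h
  exact ⟨a, b, h, ha, hb⟩

lemma isRotated_Fw {u v : List (Fin 5)} (h : u ~r v) : Fw u ~r Fw v := by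
  obtain ⟨n, hn, rfl⟩ := List.isRotated_iff_mod.1 h
  rw [List.rotate_eq_drop_append_take hn]
  conv_lhs => rw [← List.take_append_drop n u]
  simp only [Fw_append]
  exact List.isRotated_append

lemma isRotated_Fw_iterate (n : ℕ) {u v : List (Fin 5)} (h : u ~r v) :
    Fw^[n] u ~r Fw^[n] v := by
  induction n generalizing u v with
  | zero => exact h
  | succ n ih => exact ih (isRotated_Fw h)

lemma conj_iff_isRotated {u v : List (Fin 5)} : Conj u v ↔ u ~r v := by
  constructor
  · rintro ⟨s, t, rfl, rfl⟩
    exact List.isRotated_append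
  · intro h
    obtain ⟨n, hn, rfl⟩ := List.isRotated_iff_mod.1 h
    exact ⟨u.take n, u.drop n, by simp, List.rotate_eq_drop_append_take hn⟩

lemma iterate_three_mul_succ (n : ℕ) (w : List (Fin 5)) :
    Fw^[3 * (n + 1)] w = Fw (Fw (Fw (Fw^[3 * n] w))) := by
  rw [show 3 * (n + 1) = 3 * n + 1 + 1 + 1 by ring]
  simp only [Function.iterate_succ_apply']

/-- The bispecial word following `p` in the chain whose extensions `1p0` are not factors. -/
def next (p : List (Fin 5)) : List (Fin 5) := [2, 4] ++ Fw (Fw (Fw p)) ++ [0, 1, 2, 0, 3]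

lemma isRotated_next (p : List (Fin 5)) :
    1 :: next p ++ [0] ~r Fw (Fw (Fw (1 :: p ++ [0]))) := by
  have e : Fw (Fw (Fw (1 :: p ++ [0]))) = [0] ++ (1 :: next p) := by
    simp [next, F]
  rw [e]
  exact List.isRotated_append

lemma next_iff (p : List (Fin 5)) :
    FactorF (1 :: next p ++ [0]) ↔ FactorF (1 :: p ++ [0]) := by
  constructor
  · intro h
    have e₁ : 1 :: next p ++ [0] = [1] ++ Fw ([3] ++ Fw (Fw p ++ [0]) ++ [2]) ++ [0] := by
      simp [next, F]
    rw [e₁] at h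
    obtain ⟨a, b, h, ha, hb⟩ := h.desubstitute (by simp) (by simp [start_cons])
    obtain rfl := (by decide : ∀ a, EndsBlock [1] a → a = 0) a ha
    have hb' : Succ 2 b := succ (0 :: [3] ++ Fw (Fw p ++ [0])) [] (by simpa using h)
    obtain rfl := (by decide : ∀ b, BeginsBlock [0] b → Succ 2 b → b = 0) b hb hb'
    have e₂ : 0 :: ([3] ++ Fw (Fw p ++ [0]) ++ [2]) ++ [0] =
        [0, 3] ++ Fw (Fw p ++ [0]) ++ [2, 0] := by simp
    rw [e₂] at h
    obtain ⟨a, b, h, ha, hb⟩ := h.desubstitute (by simp) (by simp [start_cons])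
    obtain rfl := (by decide : ∀ a, EndsBlock [0, 3] a → a = 2) a ha
    obtain rfl := (by decide : ∀ b, BeginsBlock [2, 0] b → b = 1) b hb
    have e₃ : 2 :: (Fw p ++ [0]) ++ [1] = [2] ++ Fw p ++ [0, 1] := by simp
    rw [e₃] at h
    obtain ⟨a, b, h, ha, hb⟩ := h.desubstitute (by simp) (by simp [start_cons])
    obtain rfl := (by decide : ∀ a, EndsBlock [2] a → a = 1) a ha
    obtain rfl := (by decide : ∀ b, BeginsBlock [0, 1] b → b = 0) b hb
    exact h
  · intro h
    obtain ⟨a, b, h⟩ := h.exists_extension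
    have h := h.image.image.image
    have hb : ∀ b, Fw (Fw (F b)) = 0 :: (Fw (Fw (F b))).tail := by decide
    refine h.mono ⟨Fw (Fw (F a)) ++ [0], (Fw (Fw (F b))).tail, ?_⟩
    simp only [List.cons_append, Fw_cons, Fw_append, Fw_nil, List.append_nil]
    rw [hb b]
    simp [next, F]

/-- A bispecial word with extensions `1x2` and `3x0` but not `1x0` lies on the chain of `next`. -/
lemma eq_nil_or_eq_next {x : List (Fin 5)} (h₁ : FactorF (1 :: x ++ [2]))
    (h₃ : FactorF (3 :: x ++ [0])) :
    x = [] ∨ ∃ p, x = next p ∧ FactorF (1 :: p ++ [2]) ∧ FactorF (3 :: p ++ [0]) := by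
  rcases eq_or_ne x [] with hx | hx
  · exact Or.inl hx
  right
  obtain ⟨c, x', rfl⟩ := List.exists_cons_of_ne_nil hx
  have hc : Succ 1 c := succ [] (x' ++ [2]) (by simpa using h₁)
  obtain rfl := (by decide : ∀ c, Succ 1 c → c = 2) c hc
  obtain ⟨a, y, c, h₁, hy, ha, hc⟩ := exists_desubstitution_letters (l := [1]) h₁ (by simp)
    (by simp [start_cons]) (by simp [start_cons])
  rw [← hy] at h₃ hx ⊢
  have hy0 : y ≠ [] := by rintro rfl; exact hx rfl
  obtain ⟨b, d, h₃, hb, hd⟩ := desubstitute (l := [3]) h₃ (by simp) (by simp [start_cons])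
  clear hy hx
  obtain ⟨k, y, rfl⟩ := List.exists_cons_of_ne_nil hy0
  have hk : k = 3 ∧ a = 0 ∧ b = 2 :=
    (by decide : ∀ a b k, EndsBlock [1] a → EndsBlock [3] b → Succ a k → Succ b k →
      k = 3 ∧ a = 0 ∧ b = 2) a b k ha hb (succ [] (y ++ [c]) (by simpa using h₁))
      (succ [] (y ++ [d]) (by simpa using h₃))
  obtain ⟨rfl, rfl, rfl⟩ := hk
  have hcd : ∀ k, Succ k c → Succ k d → k = 2 ∧ d = 0 ∧ (c = 3 ∨ c = 4) := fun k hkc hkd =>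
    (by decide : ∀ c d k, BeginsBlock [2] c → BeginsBlock [0] d → Succ k c → Succ k d →
      k = 2 ∧ d = 0 ∧ (c = 3 ∨ c = 4)) c d k hc hd hkc hkd
  rcases List.eq_nil_or_concat' y with rfl | ⟨m, k, rfl⟩
  · have := hcd 3 (succ [0] [] (by simpa using h₁)) (succ [2] [] (by simpa using h₃))
    exact absurd this.1 (by decide)
  obtain ⟨rfl, rfl, hc'⟩ := hcd k (succ (0 :: 3 :: m) [] (by simpa using h₁))
    (succ (2 :: 3 :: m) [] (by simpa using h₃))
  have hm : Start (m ++ [2, c]) := by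
    rcases m with _ | ⟨e, m⟩
    · simp [start_cons]
    · rw [List.cons_append, start_cons]
      exact (by decide : ∀ e, Succ 3 e → e = 0 ∨ e = 2) e
        (succ [0] (m ++ [2, c]) (by simpa using h₁))
  obtain ⟨a, q, c', h₁, rfl, ha, hc⟩ := exists_desubstitution_letters (l := [0, 3]) (x := m)
    (r := [2, c]) (by simpa using h₁) (by simp) hm (by simp [start_cons])
  obtain ⟨b, d, h₃, hb, hd⟩ := desubstitute (l := [2, 3]) (y := q) (r := [2, 0])
    (by simpa using h₃) (by simp) (by simp [start_cons])
  obtain rfl := (by decide : ∀ a, EndsBlock [0, 3] a → a = 2) a ha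
  obtain rfl := (by decide : ∀ b, EndsBlock [2, 3] b → b = 4) b hb
  obtain rfl := (by decide : ∀ d, BeginsBlock [2, 0] d → d = 1) d hd
  have hc'' : c' = 3 ∨ c' = 4 :=
    (by decide : ∀ c c', (c = 3 ∨ c = 4) → BeginsBlock [2, c] c' → c' = 3 ∨ c' = 4) c c' hc' hc
  rcases List.eq_nil_or_concat' q with rfl | ⟨q, k, rfl⟩
  · exact absurd (succ [] [] (by simpa using h₃)) (by decide : ¬ Succ 4 1)
  have hk : k = 0 ∧ c' = 3 :=
    (by decide : ∀ k c', (c' = 3 ∨ c' = 4) → Succ k c' → Succ k 1 → k = 0 ∧ c' = 3) k c' hc''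
      (succ (2 :: q) [] (by simpa using h₁)) (succ (4 :: q) [] (by simpa using h₃))
  obtain ⟨rfl, rfl⟩ := hk
  have hq : Start (q ++ [0, 3]) := by
    rcases q with _ | ⟨e, q⟩
    · simp [start_cons]
    · rw [List.cons_append, start_cons]
      exact (by decide : ∀ e, Succ 4 e → e = 0 ∨ e = 2) e
        (succ [] (q ++ [0, 1]) (by simpa using h₃))
  obtain ⟨a, p, c, h₁, rfl, ha, hc⟩ := exists_desubstitution_letters (l := [2]) (x := q)
    (r := [0, 3]) (by simpa using h₁) (by simp) hq (by simp [start_cons])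
  obtain ⟨b, d, h₃, hb, hd⟩ := desubstitute (l := [4]) (y := p) (r := [0, 1])
    (by simpa using h₃) (by simp) (by simp [start_cons])
  obtain rfl := (by decide : ∀ a, EndsBlock [2] a → a = 1) a ha
  obtain rfl := (by decide : ∀ b, EndsBlock [4] b → b = 3) b hb
  obtain rfl := (by decide : ∀ d, BeginsBlock [0, 1] d → d = 0) d hd
  obtain rfl := (by decide : ∀ c, BeginsBlock [0, 3] c → c = 2) c hc
  exact ⟨p, by simp [next, F], h₁, h₃⟩

lemma exists_isRotated_iterate {x : List (Fin 5)} (h₁ : FactorF (1 :: x ++ [2]))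
    (h₃ : FactorF (3 :: x ++ [0])) (hx : ¬ FactorF (1 :: x ++ [0])) :
    ∃ n, 1 :: x ++ [0] ~r Fw^[3 * n] [1, 0] := by
  induction hN : x.length using Nat.strong_induction_on generalizing x with
  | _ N ih =>
  rcases eq_nil_or_eq_next h₁ h₃ with rfl | ⟨p, rfl, h₁, h₃⟩
  · exact ⟨0, List.IsRotated.refl _⟩
  · have hp : p.length < N := by
      have e₁ := length_le_length_Fw p
      have e₂ := length_le_length_Fw (Fw p)
      have e₃ := length_le_length_Fw (Fw (Fw p))
      simp only [next, List.length_append, List.length_cons, List.length_nil] at hN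
      omega
    obtain ⟨n, hn⟩ := ih _ hp h₁ h₃ (fun h => hx ((next_iff p).2 h)) rfl
    refine ⟨n + 1, (isRotated_next p).trans ?_⟩
    rw [iterate_three_mul_succ]
    exact isRotated_Fw (isRotated_Fw (isRotated_Fw hn))

lemma exists_isRotated_not_factor (n : ℕ) :
    ∃ v, v ~r Fw^[3 * n] [1, 0] ∧ ¬ FactorF v := by
  suffices ∃ x, 1 :: x ++ [0] ~r Fw^[3 * n] [1, 0] ∧ ¬ FactorF (1 :: x ++ [0]) from
    let ⟨x, hx⟩ := this
    ⟨_, hx⟩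
  induction n with
  | zero =>
    exact ⟨[], List.IsRotated.refl _, fun h =>
      absurd (succ [] [] (by simpa using h)) (by decide : ¬ Succ 1 0)⟩
  | succ n ih =>
    obtain ⟨p, hp, hp'⟩ := ih
    refine ⟨next p, (isRotated_next p).trans ?_, fun h => hp' ((next_iff p).1 h)⟩
    rw [iterate_three_mul_succ]
    exact isRotated_Fw (isRotated_Fw (isRotated_Fw hp))

lemma not_factor_3012032 : ¬ FactorF [3, 0, 1, 2, 0, 3, 2] := by
  intro h
  obtain ⟨a, b, h, ha, hb⟩ := desubstitute (l := [3]) (y := [0, 1, 2]) (r := [2]) h (by simp)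
    (by simp [start_cons])
  have hab : (a = 2 ∨ a = 4) ∧ (b = 3 ∨ b = 4) :=
    (by decide : ∀ a b, EndsBlock [3] a → BeginsBlock [2] b → Succ 2 b →
      (a = 2 ∨ a = 4) ∧ (b = 3 ∨ b = 4)) a b ha hb (succ [a, 0, 1] [] (by simpa using h))
  obtain ⟨c, d, h, hc, hd⟩ := desubstitute (l := [a]) (y := [0]) (r := [2, b]) h (by simp)
    (by simp [start_cons])
  obtain ⟨rfl, rfl⟩ : c = 3 ∧ d = 3 :=
    (by decide : ∀ a b c d, ((a = 2 ∨ a = 4) ∧ (b = 3 ∨ b = 4)) → EndsBlock [a] c →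
      BeginsBlock [2, b] d → Succ c 0 → Succ 0 d → c = 3 ∧ d = 3) a b c d hab hc hd
      (succ [] [d] (by simpa using h)) (succ [c] [] (by simpa using h))
  obtain ⟨e, g, h, he, hg⟩ := desubstitute (l := [3]) (y := []) (r := [0, 3]) h (by simp)
    (by simp [start_cons])
  exact (by decide : ∀ e g, EndsBlock [3] e → BeginsBlock [0, 3] g → ¬ Succ e g) e g he hg
    (succ [] [] (by simpa using h))

/-- Cutting a word in front of its letters `0` and `2`. -/
lemma exists_Fw_eq {w : List (Fin 5)} (hw : w.IsChain Succ) (h0 : w = [] ∨ Start w)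
    (hl : 0 ∉ w.getLast?) : ∃ v, Fw v = w := by
  induction hN : w.length using Nat.strong_induction_on generalizing w with
  | _ N ih =>
  have key : ∀ a t, w = F a ++ t → (t = [] ∨ Start t) → ∃ v, Fw v = w := by
    intro a t hwt ht
    have hlen : t.length < N := by
      have := List.length_pos_iff.2 (F_ne_nil a)
      rw [← hN, hwt, List.length_append]
      omega
    have htl : 0 ∉ t.getLast? := by
      rcases eq_or_ne t [] with rfl | htn
      · simp
      · rwa [hwt, List.getLast?_append_of_ne_nil _ htn] at hl
    obtain ⟨v, rfl⟩ := ih _ hlen (hw.infix ⟨F a, [], by simp [hwt]⟩) ht htl rfl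
    exact ⟨a :: v, by simp [hwt]⟩
  rcases h0 with rfl | ⟨a, s, rfl, ha⟩
  · exact ⟨[], rfl⟩
  rcases s with _ | ⟨b, t⟩
  · rcases ha with rfl | rfl
    · simp at hl
    · exact ⟨[1], rfl⟩
  have hab : Succ a b := (List.isChain_cons_cons.1 hw).1
  have hblock : (a = 2 ∧ b = 0) ∨ ((b = 1 ∨ b = 3 ∨ b = 4) ∧ ∃ c, F c = [a, b]) :=
    (by decide : ∀ a b, (a = 0 ∨ a = 2) → Succ a b →
      (a = 2 ∧ b = 0) ∨ ((b = 1 ∨ b = 3 ∨ b = 4) ∧ ∃ c, F c = [a, b])) a b ha hab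
  rcases hblock with ⟨rfl, rfl⟩ | ⟨hb, c, hc⟩
  · exact key 1 (0 :: t) rfl (Or.inr (by simp [start_cons]))
  · refine key c t (by simp [hc]) ?_
    rcases t with _ | ⟨d, t⟩
    · exact Or.inl rfl
    · right
      rw [start_cons]
      exact (by decide : ∀ b d, (b = 1 ∨ b = 3 ∨ b = 4) → Succ b d → d = 0 ∨ d = 2) b d hb
        (List.isChain_cons_cons.1 (List.isChain_cons_cons.1 hw).2).1

lemma of_Fw_append {y r : List (Fin 5)} (h : FactorF (Fw y ++ r)) (hr : Start r) :
    FactorF y := by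
  have hx : Start (Fw y ++ r) := by
    rcases eq_or_ne y [] with rfl | hy
    · exact hr
    · exact (start_Fw hy).append r
  obtain ⟨v₁, y', v₂, hv, e, -, -⟩ := exists_desubstitution_s1 (l := []) h hx hr
  rw [← Fw_injective e]
  exact hv.of_append v₁ v₂

lemma of_Fw_concat {y : List (Fin 5)} {k : Fin 5} (h : FactorF (Fw (y ++ [k]))) (hk : k ≠ 1) :
    FactorF (y ++ [k]) := by
  obtain ⟨a, b, h⟩ := h.exists_extension
  replace h : FactorF (Fw (y ++ [k]) ++ [b]) := of_append [a] [] (by simpa using h)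
  refine h.of_Fw_append ?_
  obtain ⟨c, e, hc, hb⟩ := (by decide : ∀ k, k ≠ 1 →
    ∃ c e, F k = [c, e] ∧ ∀ b, Succ e b → b = 0 ∨ b = 2) k hk
  rw [start_cons]
  exact hb b (succ (Fw y ++ [c]) [] (by simpa [hc] using h))

/-- If all rotations of `Fw v` are factors and `v` is not, then `v` lies on the chain of `next`. -/
lemma isRotated_of_not_factor {v : List (Fin 5)} (hlen : 2 ≤ v.length)
    (hv : ∀ w, Fw v ~r w → FactorF w) (h : ¬ FactorF v) :
    ∃ n, v ~r Fw (Fw^[3 * n] [1, 0]) := by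
  have hB : ∀ y k, v ~r (y ++ [k]) → k ≠ 1 → FactorF (y ++ [k]) := fun y k hr hk =>
    of_Fw_concat (hv _ (isRotated_Fw hr)) hk
  rcases List.eq_nil_or_concat' v with rfl | ⟨w, k, rfl⟩
  · simp at hlen
  obtain rfl : k = 1 := by
    by_contra hk
    exact h (hB w k (List.IsRotated.refl _) hk)
  rcases List.eq_nil_or_concat' w with rfl | ⟨w, d, rfl⟩
  · simp at hlen
  have hd : d ≠ 1 := by
    rintro rfl
    exact absurd (succ (Fw w) [] (by simpa [F] using hv _ (List.IsRotated.refl _)))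
      (by decide : ¬ Succ 2 2)
  have hw : FactorF ([1] ++ w ++ [d]) := by
    refine hB ([1] ++ w) d ?_ hd
    simpa using List.isRotated_append (l := w ++ [d]) (l' := [1])
  obtain ⟨b, e, hbe, hb, hd0⟩ := (by decide : ∀ d, d ≠ 1 → ∃ b e, F d = [b, e] ∧
    (b = 0 ∨ b = 2) ∧ ∀ a, EndsBlock [e] a → Succ a 1 → d = 0) d hd
  obtain rfl : d = 0 := by
    have hr : FactorF ([e] ++ Fw (1 :: w) ++ [b]) := by
      refine hv _ ?_
      rw [show Fw (w ++ [d] ++ [1]) = (Fw w ++ [b]) ++ [e, 2] by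
        simp [hbe, show F 1 = [2] from rfl]]
      exact List.isRotated_append
    obtain ⟨a, _, hr, ha, -⟩ := hr.desubstitute (by simp) (start_cons.2 hb)
    exact hd0 a ha (succ [] (w ++ [_]) (by simpa using hr))
  clear hbe hb hd0 hd
  rcases w with _ | ⟨c, w⟩
  · exact absurd ⟨1, List.infix_rfl⟩ h
  obtain rfl := (by decide : ∀ c, Succ 1 c → c = 2) c (succ [] (w ++ [0]) (by simpa using hw))
  obtain ⟨a, z, b, hw, hz, ha, hb⟩ := exists_desubstitution_letters hw (by simp)
    (by simp [start_cons]) (by simp [start_cons])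
  rw [← hz] at h hv hB hlen ⊢
  obtain rfl := (by decide : ∀ a, EndsBlock [1] a → a = 0) a ha
  have hz0 : ¬ FactorF (z ++ [0]) := fun hf => h (by simpa [F] using hf.image)
  have hb2 : b = 2 := by
    refine ((by decide : ∀ b, BeginsBlock [0] b → b = 0 ∨ b = 2) b hb).resolve_left ?_
    rintro rfl
    exact hz0 (of_append [0] [] (by simpa using hw))
  subst hb2
  rcases z with _ | ⟨c, z⟩
  · simp at hz
  rcases (by decide : ∀ c, Succ 0 c → c = 1 ∨ c = 3) c
    (succ [] (z ++ [2]) (by simpa using hw)) with rfl | rfl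
  · have h₁ : FactorF (1 :: z ++ [2]) := of_append [0] [] (by simpa using hw)
    have h₃ : FactorF (3 :: z ++ [0]) := by
      rcases z with _ | ⟨c, z⟩
      · exact ⟨4, by decide⟩
      obtain rfl := (by decide : ∀ c, Succ 1 c → c = 2) c
        (succ [] (z ++ [2]) (by simpa using h₁))
      have hr : FactorF (Fw (2 :: z) ++ [0, 1] ++ [2]) :=
        hB _ 2 (by
          rw [show Fw (1 :: 2 :: z) ++ [0] ++ [1] = [2] ++ (Fw (2 :: z) ++ [0, 1]) by simp [F]]
          exact List.isRotated_append) (by decide)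
      obtain ⟨e, _, hr⟩ := hr.exists_extension
      replace hr : FactorF ([e] ++ Fw (2 :: z) ++ [0, 1, 2]) := 
        of_append [] [_] (by simpa using hr)
      obtain ⟨a, b, hr, -, hb⟩ := hr.desubstitute (by simp) (by simp [start_cons])
      obtain rfl := (by decide : ∀ b, BeginsBlock [0, 1, 2] b → b = 0) b hb
      rcases (by decide : ∀ a, Succ a 2 → a = 1 ∨ a = 3) a
        (succ [] (z ++ [0]) (by simpa using hr)) with rfl | rfl
      · exact absurd hr hz0
      · exact hr
    obtain ⟨n, hn⟩ := exists_isRotated_iterate h₁ h₃ hz0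
    exact ⟨n, by simpa [F] using isRotated_Fw hn⟩
  · have hr : FactorF ([4] ++ Fw z ++ [0, 1] ++ [2]) :=
      hB _ 2 (by
        rw [show Fw (3 :: z) ++ [0] ++ [1] = [2] ++ ([4] ++ Fw z ++ [0, 1]) by simp [F]]
        exact List.isRotated_append) (by decide)
    obtain ⟨a, b, hr, ha, hb⟩ := desubstitute (l := [4]) (y := z) (r := [0, 1, 2])
      (by simpa using hr) (by simp) (by simp [start_cons])
    obtain rfl := (by decide : ∀ a, EndsBlock [4] a → a = 3) a ha
    obtain rfl := (by decide : ∀ b, BeginsBlock [0, 1, 2] b → b = 0) b hb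
    exact absurd hr hz0

lemma exists_isRotated_Fw {u : List (Fin 5)} (hlen : 2 ≤ u.length)
    (hu : ∀ w, u ~r w → FactorF w) : ∃ v, u ~r Fw v := by
  obtain ⟨w, hw, hs⟩ : ∃ w, u ~r w ∧ Start w := by
    rcases u with _ | ⟨a, _ | ⟨b, t⟩⟩
    · simp at hlen
    · simp at hlen
    rcases (by decide : ∀ a b, Succ a b → (a = 0 ∨ a = 2) ∨ (b = 0 ∨ b = 2)) a b
      (succ [] t (hu _ (List.IsRotated.refl _))) with h | h
    · exact ⟨_, List.IsRotated.refl _, start_cons.2 h⟩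
    · exact ⟨b :: t ++ [a], List.isRotated_append (l := [a]) (l' := b :: t),
        start_cons.2 h⟩
  obtain ⟨v, rfl⟩ := exists_Fw_eq (hu w hw).isChain (Or.inr hs) (by
    intro h0
    obtain ⟨c, s, rfl, hc⟩ := hs
    rcases List.eq_nil_or_concat' s with rfl | ⟨s, d, rfl⟩
    · have := hw.perm.length_eq
      simp at this
      omega
    · obtain rfl : d = 0 := by
        rw [← List.cons_append, List.getLast?_concat] at h0
        simpa using h0
      have := hu (0 :: c :: s) (hw.trans
        (by simpa using List.isRotated_append (l := c :: s) (l' := [0])))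
      exact (by decide : ∀ c, (c = 0 ∨ c = 2) → ¬ Succ 0 c) c hc (succ [] s this))
  exact ⟨v, hw⟩

lemma length_lt_length_Fw {v : List (Fin 5)} (hlen : 2 ≤ v.length) (hv : FactorF v) :
    v.length < (Fw v).length := by
  rcases v with _ | ⟨a, _ | ⟨b, t⟩⟩
  · simp at hlen
  · simp at hlen
  have h := (by decide : ∀ a b, Succ a b → 3 ≤ (F a).length + (F b).length) a b (succ [] t hv)
  have := length_le_length_Fw t
  simp only [Fw_cons, List.length_append, List.length_cons]
  omega

lemma classification {u : List (Fin 5)} (hlen : 2 ≤ u.length)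
    (hu : ∀ w, u ~r w → FactorF w) :
    u ~r [0, 3] ∨ u ~r [0, 1, 2, 4] ∨ (∃ d, 1 ≤ d ∧ u ~r Fw^[d] [4]) ∨
      (∃ d, 1 ≤ d ∧ u ~r Fw^[3 * d] [0]) := by
  induction hN : u.length using Nat.strong_induction_on generalizing u with
  | _ N ih =>
  obtain ⟨v, huv⟩ := exists_isRotated_Fw hlen hu
  have hv : ∀ w, Fw v ~r w → FactorF w := fun w hw => hu w (huv.trans hw)
  have hulen := huv.perm.length_eq
  rcases v with _ | ⟨a, v⟩
  · rw [hulen] at hlen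
    simp at hlen
  rcases eq_or_ne v [] with rfl | hvn
  · have hF := (by decide : ∀ a, a = 2 ∨ a = 4 ∨ (F a).length = 1 ∨
      ∃ b c, F a = [b, c] ∧ ¬ Succ c b) a
    rcases hF with rfl | rfl | h | ⟨b, c, h, hbc⟩
    · exact Or.inl huv
    · exact Or.inr (Or.inr (Or.inl ⟨1, le_rfl, huv⟩))
    · simp [h] at hulen
      omega
    · refine absurd (succ [] [] (hv [c, b] ?_)) hbc
      simpa [h] using List.isRotated_append (l := [b]) (l' := [c])
  have hvlen : 2 ≤ (a :: v).length := by
    have := List.length_pos_iff.2 hvn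
    simp only [List.length_cons]
    omega
  generalize a :: v = v at *
  by_cases hc : ∀ w, v ~r w → FactorF w
  · have hlt := length_lt_length_Fw hvlen (hc v (List.IsRotated.refl _))
    rcases ih v.length (by omega) hvlen hc rfl with h | h | ⟨d, -, h⟩ | ⟨d, -, h⟩
    · exact Or.inr (Or.inl (huv.trans (isRotated_Fw h)))
    · refine absurd (hv _ ((isRotated_Fw h).trans ?_)) not_factor_3012032
      exact List.isRotated_append (l := [0, 1, 2, 0, 3, 2]) (l' := [3])
    · refine Or.inr (Or.inr (Or.inl ⟨d + 1, by omega, huv.trans ?_⟩))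
      rw [Function.iterate_succ_apply']
      exact isRotated_Fw h
    · obtain ⟨w, hw, hwn⟩ := exists_isRotated_not_factor d
      refine absurd (hv w ((isRotated_Fw h).trans (List.IsRotated.trans ?_ hw.symm))) hwn
      rw [← Function.iterate_succ_apply' Fw, Function.iterate_succ_apply]
      exact isRotated_Fw_iterate _ (List.isRotated_append (l := [0]) (l' := [1]))
  · push Not at hc
    obtain ⟨w, hw, hwn⟩ := hc
    obtain ⟨n, hn⟩ := isRotated_of_not_factor (hw.perm.length_eq ▸ hvlen)
      (fun x hx => hv x ((isRotated_Fw hw).trans hx)) hwn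
    refine Or.inr (Or.inr (Or.inr ⟨n + 1, by omega,
      (huv.trans (isRotated_Fw (hw.trans hn))).trans ?_⟩))
    rw [← Function.iterate_succ_apply' Fw, ← Function.iterate_succ_apply' Fw, Nat.mul_succ,
      Function.iterate_add_apply _ (3 * n) 3, Function.iterate_succ_apply,
      Function.iterate_succ_apply]
    exact isRotated_Fw_iterate _ (List.isRotated_append (l := [0, 3]) (l' := [0, 1, 2]))

end FactorF

theorem complete_conjugacy_classes_in_F :
    ∀ u : List (Fin 5), 2 ≤ u.length → (∀ v, Conj u v → FactorF v) →
      Conj [0, 3] u ∨ Conj [0, 1, 2, 4] u ∨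
      (∃ d, 1 ≤ d ∧ Conj (Fw^[d] [4]) u) ∨
      (∃ d, 1 ≤ d ∧ Conj (Fw^[3 * d] [0]) u) := by
  intro u hlen hu
  simp only [FactorF.conj_iff_isRotated] at hu ⊢
  simpa only [List.isRotated_comm (l' := u)] using FactorF.classification hlen hu
end

section
/- The finite words u with |u| ≥ 2 containing at most one occurrence of the letter 1 and such that every conjugate of u is a factor of F^ω(0) are exactly the conjugates of the six words F(2) = 03, F²(2) = 0124, F(4) = 23, F²(4) = 0324, f(4) = 01240323, and f(0) = 01203, where f = F³. -/
theorem conj_iff_isRotated {u v : List (Fin 5)} : Conj u v ↔ u ~r v := by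
  constructor
  · rintro ⟨s, t, rfl, rfl⟩
    exact List.isRotated_append
  · rintro ⟨n, rfl⟩
    rw [List.rotate_eq_drop_append_take_mod]
    exact ⟨_, _, (List.take_append_drop _ u).symm, rfl⟩

theorem conj_drop_append_take (u : List (Fin 5)) (i : ℕ) : Conj u (u.drop i ++ u.take i) :=
  ⟨_, _, (List.take_append_drop i u).symm, rfl⟩

theorem Conj.exists_drop_append_take {u v : List (Fin 5)} (h : Conj u v) :
    ∃ i < u.length + 1, v = u.drop i ++ u.take i := by
  obtain ⟨s, t, rfl, rfl⟩ := h
  exact ⟨s.length, by simp, by simp⟩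

theorem length_pos_F (a : Fin 5) : 1 ≤ (F a).length := by
  fin_cases a <;> simp [F]

theorem length_le_length_Fw (w : List (Fin 5)) : w.length ≤ (Fw w).length := by
  induction w with
  | nil => simp
  | cons a w ih =>
    have := length_pos_F a
    simp only [Fw, List.flatMap_cons, List.length_append, List.length_cons] at ih ⊢
    omega

theorem Fw_append (u v : List (Fin 5)) : Fw (u ++ v) = Fw u ++ Fw v := by
  simp [Fw]

theorem Fw_infix {u v : List (Fin 5)} (h : u <:+: v) : Fw u <:+: Fw v := by
  obtain ⟨s, t, rfl⟩ := h
  exact ⟨Fw s, Fw t, by simp [Fw_append]⟩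

/-- A prefix of `Fw w` is covered by the image of the prefix of `w` of the same length. -/
theorem prefix_Fw_take {x w : List (Fin 5)} (h : x <+: Fw w) : x <+: Fw (w.take x.length) := by
  rcases le_total w.length x.length with hl | hl
  · rwa [List.take_of_length_le hl]
  · refine List.prefix_of_prefix_length_le h
      ⟨Fw (w.drop x.length), by rw [← Fw_append, List.take_append_drop]⟩ ?_
    simpa [hl] using length_le_length_Fw (w.take x.length)

/-- A factor of `Fw w` is covered by the image of a factor of `w` that is no longer. -/
theorem exists_infix_Fw {x w : List (Fin 5)} (h : x <:+: Fw w) :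
    ∃ y, y <:+: w ∧ y.length ≤ x.length ∧ x <:+: Fw y := by
  induction w generalizing x with
  | nil => exact ⟨[], List.nil_infix, by simp, h⟩
  | cons a w ih =>
    have hw : x <:+: Fw w → ∃ y, y <:+: a :: w ∧ y.length ≤ x.length ∧ x <:+: Fw y := fun hx =>
      let ⟨y, hy, hl, hxy⟩ := ih hx
      ⟨y, hy.trans (List.suffix_cons a w).isInfix, hl, hxy⟩
    rcases List.infix_append_iff_ne_nil.1 (show x <:+: F a ++ Fw w from h) with
      hx | hx | ⟨s, t, hs, -, rfl, ⟨r, hr⟩, ht⟩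
    · rcases eq_or_ne x [] with rfl | hne
      · exact ⟨[], List.nil_infix, le_rfl, List.nil_infix⟩
      · exact ⟨[a], ⟨[], w, rfl⟩, List.length_pos_iff.2 hne, by simpa [Fw] using hx⟩
    · exact hw hx
    · refine ⟨a :: w.take t.length, ?_, ?_, ?_⟩
      · exact (List.prefix_cons_inj a).2 (List.take_prefix _ _) |>.isInfix
      · have := List.length_pos_iff.2 hs
        simp only [List.length_cons, List.length_take, List.length_append]
        omega
      · obtain ⟨q, hq⟩ := prefix_Fw_take ht
        refine ⟨r, q, ?_⟩
        change _ = F a ++ Fw (w.take t.length)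
        rw [← hr, ← hq]
        simp

/-- A Boolean test for `x <+: y` that the kernel evaluates quickly. -/
def prefixTest : List (Fin 5) → List (Fin 5) → Bool
  | [], _ => true
  | _ :: _, [] => false
  | a :: x, b :: y => bif Nat.beq a.val b.val then prefixTest x y else false

/-- A Boolean test for `x <:+: y` that the kernel evaluates quickly. -/
def infixTest (x : List (Fin 5)) : List (Fin 5) → Bool
  | [] => prefixTest x []
  | b :: y => bif prefixTest x (b :: y) then true else infixTest x y

theorem prefixTest_iff {x y : List (Fin 5)} : prefixTest x y ↔ x <+: y := by
  induction x generalizing y with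
  | nil => simp [prefixTest]
  | cons a x ih =>
    cases y with
    | nil => simp [prefixTest]
    | cons b y => simp [prefixTest, ih, List.cons_prefix_cons, Fin.ext_iff]

theorem infixTest_iff {x y : List (Fin 5)} : infixTest x y ↔ x <:+: y := by
  induction y with
  | nil => simp [infixTest, prefixTest_iff]
  | cons b y ih => simp [infixTest, prefixTest_iff, ih, List.infix_cons_iff]

instance decidableInfix (x y : List (Fin 5)) : Decidable (x <:+: y) :=
  decidable_of_iff _ infixTest_iff

/-- A factor of the fixed point, long enough to contain all its factors of length at most `15`. -/
def longFactor : List (Fin 5) :=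
  [0, 1, 2, 4, 0, 1, 2, 0, 3, 2, 3, 0, 1, 2, 4, 0, 3, 2, 3, 0, 1, 2, 0, 3, 0, 1, 2, 4,
    0, 1, 2, 0, 3, 2, 3, 0, 1, 2, 0, 3, 0, 1, 2, 4, 0, 3, 2, 4, 0, 1, 2, 0, 3, 2, 3, 0,
    1, 2, 4, 0, 3, 2, 4, 0, 1, 2, 0, 3, 0, 1, 2, 4, 0, 1, 2, 0, 3]

theorem longFactor_infix : longFactor <:+: Fw^[9] [0] := by
  decide +kernel

theorem tails_Fw_longFactor :
    ∀ t ∈ (Fw longFactor).tails, t.take 15 <:+: longFactor := by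
  decide +kernel

theorem two_le_count_one_of_mem_tails :
    ∀ t ∈ longFactor.tails, 15 ≤ t.length → 2 ≤ (t.take 15).count 1 := by
  decide +kernel

/-- Representatives of the conjugacy classes in the theorem. -/
def classReps : List (List (Fin 5)) :=
  [[0, 3], [0, 1, 2, 4], [2, 3], [0, 3, 2, 4], [0, 1, 2, 4, 0, 3, 2, 3], [0, 1, 2, 0, 3]]

theorem short_factor_mem_classes :
    ∀ t ∈ longFactor.tails, ∀ n < 15, 2 ≤ (t.take n).length → (t.take n).count 1 ≤ 1 →
      (∀ i < (t.take n).length,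
        (t.take n).drop i ++ (t.take n).take i <:+: longFactor) →
      ∃ c ∈ classReps, c ~r t.take n := by
  decide +kernel

theorem classReps_spec :
    ∀ c ∈ classReps, 2 ≤ c.length ∧ c.count 1 ≤ 1 ∧
      ∀ i < c.length + 1, c.drop i ++ c.take i <:+: longFactor := by
  decide +kernel

theorem infix_longFactor_of_infix_iterate (n : ℕ) {x : List (Fin 5)} (hl : x.length ≤ 15)
    (h : x <:+: Fw^[n] [0]) : x <:+: longFactor := by
  induction n generalizing x with
  | zero => exact h.trans (show [0] <:+: longFactor by decide +kernel)
  | succ n ih =>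
    rw [Function.iterate_succ_apply'] at h
    obtain ⟨y, hy, hyl, hxy⟩ := exists_infix_Fw h
    obtain ⟨t, hxt, ht⟩ :=
      List.infix_iff_prefix_suffix.1 (hxy.trans (Fw_infix (ih (hyl.trans hl) hy)))
    refine List.IsInfix.trans ?_ (tails_Fw_longFactor t ((List.mem_tails _ _).2 ht))
    exact (List.prefix_take_iff.2 ⟨hxt, hl⟩).isInfix

theorem FactorF.infix_longFactor {x : List (Fin 5)} (h : FactorF x) (hl : x.length ≤ 15) :
    x <:+: longFactor :=
  let ⟨n, hn⟩ := h
  infix_longFactor_of_infix_iterate n hl hn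

theorem FactorF.length_lt_of_count_le {u : List (Fin 5)} (h : FactorF u) (hc : u.count 1 ≤ 1) :
    u.length < 15 := by
  by_contra! hl
  obtain ⟨n, hn⟩ := h
  have hv : FactorF (u.take 15) := ⟨n, (List.take_prefix _ _).isInfix.trans hn⟩
  obtain ⟨t, hvt, ht⟩ := List.infix_iff_prefix_suffix.1 (hv.infix_longFactor (by simp))
  have hlen : (u.take 15).length = 15 := by simpa using hl
  have htake : u.take 15 = t.take 15 := by
    rw [List.prefix_iff_eq_take.1 hvt, hlen]
  have h2 := two_le_count_one_of_mem_tails t ((List.mem_tails _ _).2 ht) (hlen ▸ hvt.length_le)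
  rw [← htake] at h2
  have := (List.take_sublist 15 u).count_le 1
  omega

theorem complete_conjugacy_classes_index_le_one :
    ∀ u : List (Fin 5),
      (2 ≤ u.length ∧ u.count 1 ≤ 1 ∧ ∀ v, Conj u v → FactorF v) ↔
      (Conj [0, 3] u ∨ Conj [0, 1, 2, 4] u ∨ Conj [2, 3] u ∨
       Conj [0, 3, 2, 4] u ∨ Conj [0, 1, 2, 4, 0, 3, 2, 3] u ∨
       Conj [0, 1, 2, 0, 3] u) := by
  intro u
  trans ∃ c ∈ classReps, Conj c u
  · constructor
    · rintro ⟨h2, hc, hu⟩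
      have hf : FactorF u := hu u (conj_iff_isRotated.2 (List.IsRotated.refl u))
      have hl := hf.length_lt_of_count_le hc
      obtain ⟨t, hut, ht⟩ := List.infix_iff_prefix_suffix.1 (hf.infix_longFactor hl.le)
      have key := short_factor_mem_classes t ((List.mem_tails _ _).2 ht) u.length hl
      rw [← List.prefix_iff_eq_take.1 hut] at key
      obtain ⟨c, hcm, hcu⟩ := key h2 hc fun i _ =>
        (hu _ (conj_drop_append_take u i)).infix_longFactor (by simp; omega)
      exact ⟨c, hcm, conj_iff_isRotated.2 hcu⟩
    · rintro ⟨c, hcm, hcu⟩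
      obtain ⟨h2, hc, hfac⟩ := classReps_spec c hcm
      have hrot := conj_iff_isRotated.1 hcu
      refine ⟨hrot.perm.length_eq ▸ h2, hrot.perm.count_eq 1 ▸ hc, fun v huv => ?_⟩
      obtain ⟨i, hi, rfl⟩ := (conj_iff_isRotated.2
        (hrot.trans (conj_iff_isRotated.1 huv))).exists_drop_append_take
      exact ⟨9, (hfac i hi).trans longFactor_infix⟩
  · simp [classReps]
end

section
/- The word 4012030124032, which is a conjugate of F⁴(2) = 0120301240324, is not a factor of the fixed point F^ω(0). -/
/-- The two-letter words that may occur in F^ω(0). -/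
def AllowedPair (a b : Fin 5) : Prop :=
  (a, b) ∈ ([(0, 1), (0, 3), (1, 2), (2, 0), (2, 3), (2, 4), (3, 0), (3, 2), (4, 0)] : List (Fin 5 × Fin 5))

instance : DecidableRel AllowedPair := fun _ _ => inferInstanceAs (Decidable (_ ∈ _))

theorem isChain_Fw {w : List (Fin 5)} (h : w.IsChain AllowedPair) :
    (Fw w).IsChain AllowedPair := by
  have single : ∀ a, (F a).IsChain AllowedPair := by decide
  have join : ∀ a b, AllowedPair a b →
      ∀ x ∈ (F a).getLast?, ∀ y ∈ (F b).head?, AllowedPair x y := by decide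
  have ne : ∀ a, F a ≠ [] := by decide
  induction w with
  | nil => exact List.isChain_nil
  | cons a l ih =>
    cases l with
    | nil => simpa [Fw] using single a
    | cons b l =>
      rw [List.isChain_cons_cons] at h
      refine List.isChain_append.2 ⟨single a, ih h.2, fun x hx y hy => join a b h.1 x hx y ?_⟩
      change y ∈ (F b ++ Fw l).head? at hy
      rwa [List.head?_append_of_ne_nil _ (ne b)] at hy

theorem isChain_iterate_Fw (n : ℕ) : (Fw^[n] [0]).IsChain AllowedPair := by
  induction n with
  | zero => exact List.isChain_singleton 0
  | succ n ih =>
    rw [Function.iterate_succ_apply']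
    exact isChain_Fw ih

theorem iterate_Fw_eq_flatMap (k : ℕ) (w : List (Fin 5)) :
    Fw^[k] w = w.flatMap fun a => Fw^[k] [a] := by
  induction k with
  | zero => simp
  | succ k ih =>
    simp only [Function.iterate_succ_apply', ih]
    simp only [Fw, List.flatMap_assoc]

/-- If all blocks `G a` are long compared to `u`, an occurrence of `u` in a concatenation of blocks
lies within two consecutive blocks. -/
theorem not_infix_flatMap {α β : Type*} {R : α → α → Prop} {G : α → List β} {u : List β}
    (hu : u ≠ []) (hlen : ∀ a, u.length ≤ (G a).length + 1)
    (hone : ∀ a, ¬ u <:+: G a) (htwo : ∀ a b, R a b → ¬ u <:+: G a ++ G b)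
    {w : List α} (hw : w.IsChain R) : ¬ u <:+: w.flatMap G := by
  induction w with
  | nil => simpa using hu
  | cons a l ih =>
    cases l with
    | nil => simpa using hone a
    | cons b l =>
      rw [List.isChain_cons_cons] at hw
      rw [List.flatMap_cons, List.infix_append_iff]
      rintro (h | h | ⟨s, t, rfl, hs, ht⟩)
      · exact hone a h
      · exact ih hw.2 h
      · rcases s with _ | ⟨c, s⟩
        · exact ih hw.2 ht.isInfix
        · have hb : t <+: G b := by
            refine List.prefix_of_prefix_length_le ht (List.prefix_append _ _) ?_
            have := hlen b
            simp only [List.length_append, List.length_cons] at this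
            omega
          obtain ⟨p, hp⟩ := hs
          obtain ⟨q, hq⟩ := hb
          exact htwo a b hw.1 ⟨p, q, by rw [← hp, ← hq]; simp⟩

theorem conj_F4_2_not_factor :
    Conj (Fw^[4] [2]) [4, 0, 1, 2, 0, 3, 0, 1, 2, 4, 0, 3, 2] ∧
    ¬ FactorF [4, 0, 1, 2, 0, 3, 0, 1, 2, 4, 0, 3, 2] := by
  refine ⟨⟨[0, 1, 2, 0, 3, 0, 1, 2, 4, 0, 3, 2], [4], by decide, by decide⟩, ?_⟩
  rintro ⟨n, hn⟩
  rcases lt_or_ge n 5 with h | h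
  · interval_cases n <;> revert hn <;> decide +kernel
  · obtain ⟨m, rfl⟩ := Nat.exists_eq_add_of_le h
    rw [Function.iterate_add_apply, iterate_Fw_eq_flatMap 5] at hn
    exact not_infix_flatMap (by decide) (by decide +kernel) (by decide +kernel)
      (by decide +kernel) (isChain_iterate_Fw m) hn
end

section
/- The word 301203012401203230124032, which is a conjugate of F⁵(2) = 012030124012032301240323, is not a factor of the fixed point F^ω(0). -/
/-- Shortest words `v` such that `u` is a prefix of `Fw v`; when the fuel `n` runs out, the
remaining letters of `u` are ignored. -/
def prefixPreimages : ℕ → List (Fin 5) → List (List (Fin 5))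
  | 0, _ => [[]]
  | _ + 1, [] => [[]]
  | n + 1, b :: u => (List.finRange 5).flatMap fun a =>
      if (b :: u) <+: F a then [[a]]
      else if F a <+: (b :: u) then
        (prefixPreimages n ((b :: u).drop (F a).length)).map (a :: ·)
      else []

/-- Words `v` one of which must occur in `w` when the nonempty word `u` occurs in `Fw w`. -/
def infixPreimages (n : ℕ) (u : List (Fin 5)) : List (List (Fin 5)) :=
  prefixPreimages n u ++ (List.finRange 5).flatMap fun a =>
    if (F a).tail ≠ [] ∧ (F a).tail <+: u then
      (prefixPreimages n (u.drop (F a).tail.length)).map (a :: ·)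
    else []

theorem Fw_cons (a : Fin 5) (w : List (Fin 5)) : Fw (a :: w) = F a ++ Fw w := by
  simp [Fw]

theorem exists_prefixPreimage (n : ℕ) (u w : List (Fin 5)) (h : u <+: Fw w) :
    ∃ v ∈ prefixPreimages n u, v <+: w := by
  induction n generalizing u w with
  | zero => exact ⟨[], by simp [prefixPreimages], List.nil_prefix⟩
  | succ n ih =>
    match u, w with
    | [], w => exact ⟨[], by simp [prefixPreimages], List.nil_prefix⟩
    | b :: u, [] => simp [Fw] at h
    | b :: u, a :: w =>
      rw [Fw_cons] at h
      by_cases h₁ : (b :: u) <+: F a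
      · refine ⟨[a], ?_, by simp⟩
        simp only [prefixPreimages, List.mem_flatMap]
        exact ⟨a, List.mem_finRange a, by simp [h₁]⟩
      · have h₂ : F a <+: b :: u :=
          (List.prefix_or_prefix_of_prefix h (List.prefix_append _ _)).resolve_left h₁
        obtain ⟨r, hr⟩ := h₂
        rw [← hr, List.prefix_append_right_inj] at h
        obtain ⟨v, hv, hvw⟩ := ih r w h
        refine ⟨a :: v, ?_, List.cons_prefix_cons.2 ⟨rfl, hvw⟩⟩
        simp only [prefixPreimages, List.mem_flatMap]
        refine ⟨a, List.mem_finRange a, ?_⟩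
        rw [if_neg h₁, if_pos ⟨r, hr⟩, ← hr, List.drop_left]
        exact List.mem_map_of_mem hv

theorem F_tail_length_le (a : Fin 5) : (F a).tail.length ≤ 1 := by
  revert a; decide

theorem F_ne_nil (a : Fin 5) : F a ≠ [] := by
  revert a; decide

theorem exists_infixPreimage (n : ℕ) (u w : List (Fin 5)) (hu : u ≠ []) (h : u <:+: Fw w) :
    ∃ v ∈ infixPreimages n u, v <:+: w := by
  induction w with
  | nil => simp [Fw, hu] at h
  | cons a w ih =>
    have of_prefix (x : List (Fin 5)) (hx : u <+: Fw x) :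
        ∃ v ∈ infixPreimages n u, v <:+: x := by
      obtain ⟨v, hv, hvx⟩ := exists_prefixPreimage n u x hx
      exact ⟨v, List.mem_append_left _ hv, hvx.isInfix⟩
    have of_infix (hx : u <:+: Fw w) : ∃ v ∈ infixPreimages n u, v <:+: a :: w := by
      obtain ⟨v, hv, hvw⟩ := ih hx
      exact ⟨v, hv, hvw.trans (List.suffix_cons a w).isInfix⟩
    have hcons : Fw (a :: w) = (F a).head (F_ne_nil a) :: ((F a).tail ++ Fw w) := by
      rw [Fw_cons, ← List.cons_append, List.cons_head_tail]
    rw [hcons, List.infix_cons_iff, ← hcons] at h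
    rcases h with h | h
    · exact of_prefix _ h
    by_cases ht : (F a).tail = []
    · rw [ht] at h
      exact of_infix h
    obtain ⟨c, hc⟩ : ∃ c, (F a).tail = [c] := by
      rw [← List.length_eq_one_iff]
      have := F_tail_length_le a
      have := List.length_pos_iff.2 ht
      omega
    rw [hc, List.singleton_append, List.infix_cons_iff] at h
    rcases h with h | h
    · obtain ⟨b, u, rfl⟩ := List.exists_cons_of_ne_nil hu
      obtain ⟨rfl, hprefix⟩ := List.cons_prefix_cons.1 h
      obtain ⟨v, hv, hvw⟩ := exists_prefixPreimage n u w hprefix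
      refine ⟨a :: v, List.mem_append_right _ ?_,
        (List.cons_prefix_cons.2 ⟨rfl, hvw⟩).isInfix⟩
      refine List.mem_flatMap.2 ⟨a, List.mem_finRange a, ?_⟩
      rw [if_pos ⟨ht, by simp [hc]⟩, hc]
      exact List.mem_map_of_mem hv
    · exact of_infix h

/-- A finite set of nonempty words that is closed under desubstitution (up to taking factors)
and avoids the factors of `[0]` contains no factor of the fixed point. -/
theorem not_factorF_of_closed (n : ℕ) (B : List (List (Fin 5)))
    (hB : ∀ b ∈ B, b ≠ [] ∧ ¬ b <:+: [0])
    (hclosed : ∀ b ∈ B, ∀ v ∈ infixPreimages n b, ∃ c ∈ B, c <:+: v)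
    (b : List (Fin 5)) (hb : b ∈ B) : ¬ FactorF b := by
  rintro ⟨k, hk⟩
  induction k generalizing b with
  | zero => exact (hB b hb).2 hk
  | succ k ih =>
    rw [Function.iterate_succ_apply'] at hk
    obtain ⟨v, hv, hvw⟩ := exists_infixPreimage n b _ (hB b hb).1 hk
    obtain ⟨c, hc, hcv⟩ := hclosed b hb v hv
    exact ih c hc (hcv.trans hvw)

/-- The two-letter words that do not occur in the fixed point, and the iterated preimages of the
word `301203012401203230124032` that avoid them. -/
def forbiddenWords : List (List (Fin 5)) :=
  [[0, 0], [0, 2], [0, 4], [1, 0], [1, 1], [1, 3], [1, 4], [2, 1], [2, 2], [3, 1], [3, 3],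
   [3, 4], [4, 1], [4, 2], [4, 3], [4, 4],
   [3, 0, 3], [2, 0, 1, 2, 3], [2, 0, 1, 2, 4], [4, 0, 1, 2, 3], [4, 0, 1, 2, 4],
   [3, 0, 1, 2, 0, 3, 2, 3], [3, 0, 1, 2, 0, 3, 2, 4],
   [2, 0, 1, 2, 0, 3, 0, 1, 2, 4, 0, 3, 2, 3], [2, 0, 1, 2, 0, 3, 0, 1, 2, 4, 0, 3, 2, 4],
   [4, 0, 1, 2, 0, 3, 0, 1, 2, 4, 0, 3, 2, 3], [4, 0, 1, 2, 0, 3, 0, 1, 2, 4, 0, 3, 2, 4],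
   [3, 0, 1, 2, 0, 3, 0, 1, 2, 4, 0, 1, 2, 0, 3, 2, 3, 0, 1, 2, 4, 0, 3, 2]]

theorem forbiddenWords_closed :
    ∀ b ∈ forbiddenWords, ∀ v ∈ infixPreimages 24 b, ∃ c ∈ forbiddenWords, c <:+: v := by
  decide +kernel

theorem conj_F5_2_not_factor :
    Conj (Fw^[5] [2])
      [3, 0, 1, 2, 0, 3, 0, 1, 2, 4, 0, 1, 2, 0, 3, 2, 3, 0, 1, 2, 4, 0, 3, 2] ∧
    ¬ FactorF
      [3, 0, 1, 2, 0, 3, 0, 1, 2, 4, 0, 1, 2, 0, 3, 2, 3, 0, 1, 2, 4, 0, 3, 2] := by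
  constructor
  · exact ⟨[0, 1, 2, 0, 3, 0, 1, 2, 4, 0, 1, 2, 0, 3, 2, 3, 0, 1, 2, 4, 0, 3, 2], [3],
      by decide +kernel, rfl⟩
  · refine not_factorF_of_closed 24 forbiddenWords (by decide +kernel) forbiddenWords_closed _ ?_
    decide +kernel
end

section
/- Let w be a finite word over {a,b,c,d,e} such that every conjugate of w is a factor of w₅ = G(F^ω(0)), w has prefix ab, and |w| ≥ 101. Then there exists a finite word v over {0,1,2,3,4} such that w = g(v) (where g = G∘F²), and every conjugate of v is a factor of F^ω(0). -/
/-- The morphism f = F³ on words. -/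
def fword (w : List (Fin 5)) : List (Fin 5) := Fw (Fw (Fw w))

/-- The morphism g = G ∘ F² on words. -/
def gword (w : List (Fin 5)) : List (Fin 5) := Gw (Fw (Fw w))

/-- g(f^k(w)). -/
def gf (k : ℕ) (w : List (Fin 5)) : List (Fin 5) := gword (fword^[k] w)

theorem gword_append (u v : List (Fin 5)) : gword (u ++ v) = gword u ++ gword v := by
  simp [gword, Gw, Fw]

theorem gword_nil : gword [] = [] := rfl

theorem gword_cons (c : Fin 5) (v : List (Fin 5)) : gword (c :: v) = gword [c] ++ gword v :=
  gword_append [c] v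

theorem gword_singleton_prefix (c : Fin 5) : ∃ r, gword [c] = 0 :: 1 :: 2 :: r := by
  fin_cases c <;> exact ⟨_, rfl⟩

theorem gword_singleton_length (c : Fin 5) : (gword [c]).length ≤ 16 := by
  revert c; decide

theorem gword_eq_nil_or_prefix (v : List (Fin 5)) :
    v = [] ∨ ∃ r, gword v = 0 :: 1 :: 2 :: r := by
  rcases v with _ | ⟨c, v⟩
  · exact .inl rfl
  · obtain ⟨r, hr⟩ := gword_singleton_prefix c
    exact .inr ⟨r ++ gword v, by rw [gword_cons, hr]; rfl⟩

theorem iterate_Fw_append (n : ℕ) (u v : List (Fin 5)) :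
    Fw^[n] (u ++ v) = Fw^[n] u ++ Fw^[n] v := by
  induction n generalizing u v with
  | zero => rfl
  | succ n ih => simp only [Function.iterate_succ_apply, Fw_append, ih]

theorem iterate_Fw_prefix_succ (n : ℕ) : Fw^[n] [0] <+: Fw^[n + 1] [0] := by
  rw [Function.iterate_succ_apply, show Fw [0] = [0] ++ [1] from rfl, iterate_Fw_append]
  exact List.prefix_append _ _

/-- Since `F^ω(0)` is fixed by `F`, the factors of `w₅` are those of `g(F^ω(0))`. -/
theorem FactorW5.exists_infix_gword {u : List (Fin 5)} (h : FactorW5 u) :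
    ∃ n, u <:+: gword (Fw^[n] [0]) := by
  obtain ⟨n, hn⟩ := h
  refine ⟨n, hn.trans ?_⟩
  obtain ⟨r, hr⟩ := (iterate_Fw_prefix_succ n).trans (iterate_Fw_prefix_succ (n + 1))
  have : gword (Fw^[n] [0]) = Gw (Fw^[n] [0]) ++ Gw r := by
    rw [gword, ← Function.iterate_succ_apply' Fw, ← Function.iterate_succ_apply' Fw, ← hr]
    simp [Gw]
  rw [this]
  exact (List.prefix_append _ _).isInfix

theorem eq_nil_of_gword_singleton_eq {c : Fin 5} {p a : List (Fin 5)}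
    (h : gword [c] = p ++ 0 :: 1 :: a) : p = [] := by
  have key : ∀ c : Fin 5, ∀ i < 17, [0, 1] <+: (gword [c]).drop i → i = 0 := by decide
  have hl := gword_singleton_length c
  have := key c p.length (by rw [h] at hl; simp at hl; omega) (by simp [h])
  exact List.length_eq_zero_iff.mp this

theorem eq_singleton_of_gword_singleton_eq {c : Fin 5} {p a : List (Fin 5)}
    (h : gword [c] = p ++ 1 :: 2 :: a) : p = [0] := by
  have key : ∀ c : Fin 5, ∀ i < 17, [1, 2] <+: (gword [c]).drop i →
      (gword [c]).take i = [0] := by decide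
  have hl := gword_singleton_length c
  have := key c p.length (by rw [h] at hl; simp at hl; omega) (by simp [h])
  simpa [h] using this

theorem gword_singleton_ne_concat {c : Fin 5} {p : List (Fin 5)} {x : Fin 5}
    (hx : x = 0 ∨ x = 1) : gword [c] ≠ p ++ [x] := by
  intro h
  have key : ∀ c : Fin 5, (gword [c]).getLast? ≠ some 0 ∧ (gword [c]).getLast? ≠ some 1 := by
    decide
  have := key c
  rw [h] at this
  rcases hx with rfl | rfl <;> simp at this

/-- Every occurrence of `ab` in an image of `g` is at the start of a block. -/
theorem exists_split_of_gword_eq {X p q : List (Fin 5)} (h : gword X = p ++ 0 :: 1 :: q) :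
    ∃ X₁ X₂, X = X₁ ++ X₂ ∧ gword X₁ = p ∧ gword X₂ = 0 :: 1 :: q := by
  induction X generalizing p with
  | nil => simp [gword_nil] at h
  | cons c X ih =>
    have h' := h
    rw [gword_cons] at h'
    have later (p' : List (Fin 5)) (hp : p = gword [c] ++ p')
        (hX : gword X = p' ++ 0 :: 1 :: q) :
        ∃ X₁ X₂, c :: X = X₁ ++ X₂ ∧ gword X₁ = p ∧ gword X₂ = 0 :: 1 :: q := by
      obtain ⟨X₁, X₂, rfl, h₁, h₂⟩ := ih hX
      exact ⟨c :: X₁, X₂, rfl, by rw [gword_cons, h₁, hp], h₂⟩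
    rcases List.append_eq_append_iff.mp h' with ⟨p', hp, hX⟩ | ⟨a, hc, ha⟩
    · exact later p' hp hX
    · rcases a with _ | ⟨x, _ | ⟨y, a⟩⟩
      · exact later [] (by simpa using hc.symm) (by simpa using ha.symm)
      · simp only [List.cons_append, List.cons.injEq] at ha
        exact absurd hc (gword_singleton_ne_concat (.inl ha.1.symm))
      · simp only [List.cons_append, List.cons.injEq] at ha
        obtain ⟨rfl, rfl, -⟩ := ha
        obtain rfl := eq_nil_of_gword_singleton_eq hc
        exact ⟨[], c :: X, rfl, rfl, h⟩

/-- Every occurrence of `bc` in an image of `g` is preceded by `a`. -/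
theorem exists_eq_concat_of_gword_eq {X p q : List (Fin 5)} (h : gword X = p ++ 1 :: 2 :: q) :
    ∃ p', p = p' ++ [0] := by
  induction X generalizing p with
  | nil => simp [gword_nil] at h
  | cons c X ih =>
    rw [gword_cons] at h
    rcases List.append_eq_append_iff.mp h with ⟨p', rfl, hX⟩ | ⟨a, hc, ha⟩
    · obtain ⟨p'', rfl⟩ := ih hX
      exact ⟨gword [c] ++ p'', by simp⟩
    · rcases a with _ | ⟨x, _ | ⟨y, a⟩⟩
      · rcases gword_eq_nil_or_prefix X with rfl | ⟨r, hr⟩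
        · simp [gword_nil] at ha
        · simp [hr] at ha
      · simp only [List.cons_append, List.cons.injEq] at ha
        exact absurd hc (gword_singleton_ne_concat (.inr ha.1.symm))
      · simp only [List.cons_append, List.cons.injEq] at ha
        obtain ⟨rfl, rfl, -⟩ := ha
        exact ⟨[], eq_singleton_of_gword_singleton_eq hc⟩

theorem prefix_of_gword_eq {v X q : List (Fin 5)} (h : gword X = gword v ++ 0 :: q) :
    v <+: X := by
  induction v generalizing X with
  | nil => exact List.nil_prefix
  | cons c v ih =>
    rcases X with _ | ⟨d, X⟩
    · simp [gword_nil] at h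
    · rw [gword_cons d, gword_cons c, List.append_assoc] at h
      obtain rfl : d = c := by
        obtain ⟨r, hr⟩ : ∃ r, gword v ++ 0 :: q = 0 :: r := by
          rcases gword_eq_nil_or_prefix v with rfl | ⟨r, hr⟩
          · exact ⟨q, rfl⟩
          · exact ⟨_, by rw [hr]; rfl⟩
        rw [hr] at h
        rcases gword_eq_nil_or_prefix X with rfl | ⟨s, hs⟩
        · rw [gword_nil] at h
          fin_cases c <;> fin_cases d <;> first | rfl | simp [gword, Gw, Fw, F, G] at h
        · rw [hs] at h
          fin_cases c <;> fin_cases d <;> first | rfl | simp [gword, Gw, Fw, F, G] at h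
      exact List.cons_prefix_cons.mpr ⟨rfl, ih (List.append_cancel_left h)⟩

theorem exists_gword_eq_of_conj_factor {w : List (Fin 5)}
    (hw : ∀ v, Conj w v → FactorW5 v) (hab : [0, 1] <+: w) (hlen : 101 ≤ w.length) :
    ∃ v, w = gword v := by
  obtain ⟨n, p, r, h⟩ := (hw w ⟨[], w, rfl, by simp⟩).exists_infix_gword
  obtain ⟨w', rfl⟩ := hab
  obtain ⟨-, X, -, -, hX⟩ := exists_split_of_gword_eq (p := p) (q := w' ++ r)
    (by rw [← h]; simp)
  rcases X with _ | ⟨c, X⟩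
  · simp [gword_nil] at hX
  rw [gword_cons] at hX
  obtain ⟨w₂, h₂⟩ : gword [c] <+: [0, 1] ++ w' :=
    List.prefix_of_prefix_length_le ⟨_, hX⟩ ⟨r, rfl⟩
      ((gword_singleton_length c).trans (by omega))
  rw [← h₂] at hw hlen ⊢
  have hX₂ : gword X = w₂ ++ r := by
    apply List.append_cancel_left (as := gword [c])
    rw [hX, ← List.append_assoc, h₂]; rfl
  obtain ⟨w₃, rfl⟩ : ∃ w₃, w₂ = 0 :: 1 :: w₃ := by
    have hl := gword_singleton_length c
    rw [List.length_append] at hlen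
    rcases w₂ with _ | ⟨x, _ | ⟨y, w₃⟩⟩
    · simp at hlen; omega
    · simp at hlen; omega
    · rcases gword_eq_nil_or_prefix X with rfl | ⟨s, hs⟩
      · simp [gword_nil] at hX₂
      · simp only [hs, List.cons_append, List.cons.injEq] at hX₂
        obtain ⟨rfl, rfl, -⟩ := hX₂
        exact ⟨w₃, rfl⟩
  obtain ⟨m, p', r', h'⟩ := (hw _ ⟨_, _, rfl, rfl⟩).exists_infix_gword
  obtain ⟨-, Y, -, -, hY⟩ := exists_split_of_gword_eq (p := p') (q := w₃ ++ gword [c] ++ r')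
    (by rw [← h']; simp)
  obtain ⟨s, hs⟩ := gword_singleton_prefix c
  obtain ⟨Y₁, -, -, hY₁, -⟩ := exists_split_of_gword_eq (p := 0 :: 1 :: w₃)
    (q := 2 :: s ++ r') (by rw [hY, hs]; simp)
  exact ⟨c :: Y₁, by rw [gword_cons c Y₁, hY₁]⟩

/-- If moving the first letter of `g(v)` to the end gives a factor of `w₅`, then `v` is a factor
of `F^ω(0)`. -/
theorem factorF_of_factorW5_concat {v y : List (Fin 5)} (hv : gword v = 0 :: y)
    (h : FactorW5 (y ++ [0])) : FactorF v := by
  obtain ⟨n, p, r, hn⟩ := h.exists_infix_gword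
  obtain ⟨z, rfl⟩ : ∃ z, y = 1 :: 2 :: z := by
    rcases gword_eq_nil_or_prefix v with rfl | ⟨z, hz⟩
    · simp [gword_nil] at hv
    · exact ⟨z, by simpa using hv.symm.trans hz⟩
  obtain ⟨p', rfl⟩ := exists_eq_concat_of_gword_eq (X := Fw^[n] [0]) (p := p)
    (q := z ++ 0 :: r) (by rw [← hn]; simp)
  obtain ⟨X₁, X₂, hX, -, h₂⟩ := exists_split_of_gword_eq (X := Fw^[n] [0]) (p := p')
    (q := 2 :: z ++ 0 :: r) (by rw [← hn]; simp)
  obtain ⟨s, hs⟩ := prefix_of_gword_eq (v := v) (X := X₂) (q := r) (by rw [h₂, hv]; simp)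
  exact ⟨n, X₁, s, by rw [hX, ← hs]; simp⟩

theorem descent_of_conjugacy_classes_w5 :
    ∀ w : List (Fin 5),
      (∀ v, Conj w v → FactorW5 v) → [0, 1] <+: w → 101 ≤ w.length →
      ∃ v : List (Fin 5), w = gword v ∧ ∀ v', Conj v v' → FactorF v' := by
  intro w hw hab hlen
  obtain ⟨v, rfl⟩ := exists_gword_eq_of_conj_factor hw hab hlen
  refine ⟨v, rfl, ?_⟩
  have key (s t : List (Fin 5)) (ht : t ≠ []) (hst : v = s ++ t) : FactorF (t ++ s) := by
    obtain ⟨r, hr⟩ := (gword_eq_nil_or_prefix t).resolve_left ht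
    refine factorF_of_factorW5_concat (y := 1 :: 2 :: r ++ gword s)
      (by rw [gword_append, hr]; rfl) (hw _ ⟨gword s ++ [0], 1 :: 2 :: r, ?_, by simp⟩)
    rw [hst, gword_append, hr]; simp
  rintro v' ⟨s, t, hst, rfl⟩
  rcases eq_or_ne t [] with rfl | ht
  · have hv : v ≠ [] := by
      rintro rfl
      simp [gword_nil] at hlen
    have := key [] v hv rfl
    simpa [hst] using this
  · exact key s t ht hst
end
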